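/- Let F = (X_n, K_n, π_n)_{n≥1} be a family of irreducible birth and death chains on X_n = {0,1,...,n} and F_c the family of associated continuous-time chains. For a ∈ (0,1), let M_n(a) ∈ X_n satisfy π_n([0,M_n(a)]) ≥ a and π_n([M_n(a),n]) ≥ 1−a, let λ_n(a) be the smallest eigenvalue of the principal submatrix of I − K_n indexed by 0,...,M_n(a)−1, and set u_n(a) = E_0 τ̃^{(n)}_{M_n(a)} and v_n(a)² = Var_0 τ̃^{(n)}_{M_n(a)}. Assume π_n(0) → 0. Then the following are equivalent: (1) F_c^L has a total variation cutoff; (2) u_n(a)/v_n(a) → ∞ for all a ∈ (0,1); (3) u_n(a)λ_n(a) → ∞ for all a ∈ (0,1); (4) there exist a ∈ (0,1) and a positive sequence (t_n) with t_n = O(u_n(c)) for all c ∈ (0,1) such that P_0(τ̃^{(n)}_{M_n(a)} > (1−ε)t_n) → 1 for all ε ∈ (0,1), and for every b ∈ (a,1) there is α_b ∈ (0,1) with limsup_n P_0(τ̃^{(n)}_{M_n(b)} > (1+ε)t_n) ≤ α_b for all ε > 0. Furthermore, if (2) or (3) holds, then F_c^L has a cutoff with cutoff time u_n(a) for any a ∈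 (0,1); if (4) holds, then F_c^L has a cutoff with cutoff time (t_n). -/

import Mathlib

open scoped BigOperators
open Filter Matrix Polynomial MeasureTheory

noncomputable section

/-- An irreducible birth and death chain on `{0,1,...,n}`, together with its
(unique) stationary distribution. -/
structure BDChain (n : ℕ) where
  K : Matrix (Fin (n + 1)) (Fin (n + 1)) ℝ
  pi : Fin (n + 1) → ℝ
  K_nonneg : ∀ i j, 0 ≤ K i j
  K_rowSum : ∀ i, ∑ j, K i j = 1
  K_tridiag : ∀ i j : Fin (n + 1), 1 < |(i : ℤ) - (j : ℤ)| → K i j = 0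
  K_irred : ∀ i : ℕ, ∀ h : i < n,
    0 < K ⟨i, by omega⟩ ⟨i + 1, by omega⟩ ∧ 0 < K ⟨i + 1, by omega⟩ ⟨i, by omega⟩
  pi_pos : ∀ i, 0 < pi i
  pi_sum : ∑ i, pi i = 1
  pi_stat : ∀ j, ∑ i, pi i * K i j = pi j

namespace BDChain

variable {n : ℕ}

/-- `π([0,M])` -/
def piLow (c : BDChain n) (M : Fin (n + 1)) : ℝ :=
  ∑ ℓ : Fin (n + 1), if ℓ ≤ M then c.pi ℓ else 0

/-- `π([M,n])` -/
def piHigh (c : BDChain n) (M : Fin (n + 1)) : ℝ :=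
  ∑ ℓ : Fin (n + 1), if M ≤ ℓ then c.pi ℓ else 0

/-- `π([a,b])` -/
def piInt (c : BDChain n) (a b : Fin (n + 1)) : ℝ :=
  ∑ ℓ : Fin (n + 1), if a ≤ ℓ ∧ ℓ ≤ b then c.pi ℓ else 0

/-- The substochastic matrix of the chain killed at state `i`. -/
def killed (c : BDChain n) (i : Fin (n + 1)) : Matrix (Fin (n + 1)) (Fin (n + 1)) ℝ :=
  Matrix.of fun x y => if x = i ∨ y = i then 0 else c.K x y

/-- `P_j(τ_i > m)`, where `τ_i` is the discrete-time hitting time of state `i`. -/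
def hitSurv (c : BDChain n) (i j : Fin (n + 1)) (m : ℕ) : ℝ :=
  if j = i then 0 else ∑ y, (c.killed i ^ m) j y

/-- `P_j(τ̃_i > t)`, where `τ̃_i` is the continuous-time hitting time of state `i`. -/
def hitSurvC (c : BDChain n) (i j : Fin (n + 1)) (t : ℝ) : ℝ :=
  ∑' m : ℕ, (Real.exp (-t) * t ^ m / m.factorial) * c.hitSurv i j m

/-- `E_j τ_i` -/
def hitMean (c : BDChain n) (i j : Fin (n + 1)) : ℝ :=
  ∑' m : ℕ, c.hitSurv i j m

/-- `Var_j τ_i` -/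
def hitVar (c : BDChain n) (i j : Fin (n + 1)) : ℝ :=
  (∑' m : ℕ, (2 * (m : ℝ) + 1) * c.hitSurv i j m) - (c.hitMean i j) ^ 2

/-- `E_j τ̃_i` -/
def hitMeanC (c : BDChain n) (i j : Fin (n + 1)) : ℝ :=
  ∫ t in Set.Ioi (0 : ℝ), c.hitSurvC i j t

/-- `Var_j τ̃_i` -/
def hitVarC (c : BDChain n) (i j : Fin (n + 1)) : ℝ :=
  (∫ t in Set.Ioi (0 : ℝ), 2 * t * c.hitSurvC i j t) - (c.hitMeanC i j) ^ 2

/-- The substochastic matrix of the chain killed at states `i` and `k`. -/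
def killed2 (c : BDChain n) (i k : Fin (n + 1)) : Matrix (Fin (n + 1)) (Fin (n + 1)) ℝ :=
  Matrix.of fun x y => if x = i ∨ x = k ∨ y = i ∨ y = k then 0 else c.K x y

/-- `P_j(min{τ_i, τ_k} > m)` -/
def hitSurv2 (c : BDChain n) (i k j : Fin (n + 1)) (m : ℕ) : ℝ :=
  if j = i ∨ j = k then 0 else ∑ y, (c.killed2 i k ^ m) j y

/-- `E_j min{τ_i, τ_k}` -/
def hitMean2 (c : BDChain n) (i k j : Fin (n + 1)) : ℝ :=
  ∑' m : ℕ, c.hitSurv2 i k j m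

/-- `E_j min{τ̃_i, τ̃_k}` -/
def hitMean2C (c : BDChain n) (i k j : Fin (n + 1)) : ℝ :=
  ∫ t in Set.Ioi (0 : ℝ),
    ∑' m : ℕ, (Real.exp (-t) * t ^ m / m.factorial) * c.hitSurv2 i k j m

/-- The continuous-time kernel `H_t(x,y) = e^{-t(I-K)}(x,y)`. -/
def Ht (c : BDChain n) (t : ℝ) (x y : Fin (n + 1)) : ℝ :=
  ∑' m : ℕ, (Real.exp (-t) * t ^ m / m.factorial) * (c.K ^ m) x y

/-- Discrete-time total variation distance from starting state `x` at time `m`. -/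
def dTV (c : BDChain n) (x : Fin (n + 1)) (m : ℕ) : ℝ :=
  ⨆ A : Finset (Fin (n + 1)), (∑ y ∈ A, (c.K ^ m) x y - ∑ y ∈ A, c.pi y)

/-- Continuous-time total variation distance from starting state `x` at time `t`. -/
def dTVC (c : BDChain n) (x : Fin (n + 1)) (t : ℝ) : ℝ :=
  ⨆ A : Finset (Fin (n + 1)), (∑ y ∈ A, c.Ht t x y - ∑ y ∈ A, c.pi y)

/-- Maximum (over starting states) discrete-time total variation distance. -/
def dTVMax (c : BDChain n) (m : ℕ) : ℝ := ⨆ x, c.dTV x m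

/-- Maximum (over starting states) continuous-time total variation distance. -/
def dTVMaxC (c : BDChain n) (t : ℝ) : ℝ := ⨆ x, c.dTVC x t

/-- Discrete-time separation from starting state `x` at time `m`. -/
def sep (c : BDChain n) (x : Fin (n + 1)) (m : ℕ) : ℝ :=
  ⨆ y, (1 - (c.K ^ m) x y / c.pi y)

/-- Continuous-time separation from starting state `x` at time `t`. -/
def sepC (c : BDChain n) (x : Fin (n + 1)) (t : ℝ) : ℝ :=
  ⨆ y, (1 - c.Ht t x y / c.pi y)

end BDChain

/-- Discrete-time `ε`-mixing time for a distance profile `d`. -/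
def mixD (d : ℕ → ℝ) (ε : ℝ) : ℕ := sInf {m : ℕ | d m ≤ ε}

/-- Continuous-time `ε`-mixing time for a distance profile `d`. -/
def mixC (d : ℝ → ℝ) (ε : ℝ) : ℝ := sInf {t : ℝ | 0 ≤ t ∧ d t ≤ ε}

/-- The set of (real) eigenvalues of a square matrix. -/
def eigSet {ι : Type*} [Fintype ι] (M : Matrix ι ι ℝ) : Set ℝ :=
  {x | ∃ v : ι → ℝ, v ≠ 0 ∧ M.mulVec v = x • v}

/-- `l` is the smallest non-zero eigenvalue of `M`. -/
def IsSmallestNonzeroEig {ι : Type*} [Fintype ι] (M : Matrix ι ι ℝ) (l : ℝ) : Prop :=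
  l ∈ eigSet M ∧ l ≠ 0 ∧ ∀ x ∈ eigSet M, x ≠ 0 → l ≤ x

/-- `l` is the smallest eigenvalue of `M`. -/
def IsSmallestEig {ι : Type*} [Fintype ι] (M : Matrix ι ι ℝ) (l : ℝ) : Prop :=
  l ∈ eigSet M ∧ ∀ x ∈ eigSet M, l ≤ x

/-- The principal submatrix of `I - K` indexed by the states `0, 1, ..., M-1`. -/
def BDChain.subIK {n : ℕ} (c : BDChain n) (M : Fin (n + 1)) :
    Matrix (Fin (M : ℕ)) (Fin (M : ℕ)) ℝ :=
  Matrix.of fun a b =>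
    (1 - c.K) (Fin.castLE M.isLt.le a) (Fin.castLE M.isLt.le b)

/-- A family of chains, with `ε ↦ n ↦ T ε n` the mixing time profile, presents a cutoff
with cutoff time `t`. -/
def cutoffWith (T : ℝ → ℕ → ℝ) (t : ℕ → ℝ) : Prop :=
  ∀ ε ∈ Set.Ioo (0 : ℝ) 1, Filter.Tendsto (fun n => T ε n / t n) Filter.atTop (nhds 1)

/-- A family of chains presents a cutoff. -/
def hasCutoff (T : ℝ → ℕ → ℝ) : Prop :=
  ∃ t : ℕ → ℝ, (∀ n, 0 < t n) ∧ cutoffWith T t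

/-- A family of chains presents a `(t_n, b_n)` cutoff. -/
def cutoffWindow (T : ℝ → ℕ → ℝ) (t b : ℕ → ℝ) : Prop :=
  (∀ᶠ n in Filter.atTop, 0 < t n) ∧ (∀ᶠ n in Filter.atTop, 0 < b n) ∧
  Filter.Tendsto (fun n => b n / t n) Filter.atTop (nhds 0) ∧
  ∀ ε ∈ Set.Ioo (0 : ℝ) 1, ∃ C : ℝ, ∀ᶠ n in Filter.atTop, |T ε n - t n| ≤ C * b n

/-- The average of the sequence `a` over a Poisson variable of parameter `t`. -/
def poissonMix (a : ℕ → ℝ) (t : ℝ) : ℝ :=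
  ∑' m : ℕ, (Real.exp (-t) * t ^ m / m.factorial) * a m

namespace poissonMix

theorem summable_pow_div {a : ℕ → ℝ} {C : ℝ} (ha : ∀ m, |a m| ≤ C) (t : ℝ) :
    Summable fun m : ℕ => t ^ m / m.factorial * a m := by
  refine Summable.of_norm_bounded (g := fun m : ℕ => |t| ^ m / m.factorial * C)
    ((Real.summable_pow_div_factorial |t|).mul_right C) fun m => ?_
  rw [norm_mul, norm_div, norm_pow, Real.norm_eq_abs, RCLike.norm_natCast]
  gcongr
  exact ha m

theorem summable {a : ℕ → ℝ} {C : ℝ} (ha : ∀ m, |a m| ≤ C) (t : ℝ) :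
    Summable fun m : ℕ => (Real.exp (-t) * t ^ m / m.factorial) * a m := by
  refine ((summable_pow_div ha t).mul_left (Real.exp (-t))).congr fun m => ?_
  ring

theorem eq_exp_mul (a : ℕ → ℝ) (t : ℝ) :
    poissonMix a t = Real.exp (-t) * ∑' m : ℕ, t ^ m / m.factorial * a m := by
  rw [poissonMix, ← tsum_mul_left]
  exact tsum_congr fun m => by ring

theorem zero_right (a : ℕ → ℝ) : poissonMix a 0 = a 0 := by
  rw [poissonMix, tsum_eq_single 0]
  · simp
  · intro m hm
    simp [hm]

theorem mono {a b : ℕ → ℝ} {C D t : ℝ} (ha : ∀ m, |a m| ≤ C) (hb : ∀ m, |b m| ≤ D)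
    (hab : ∀ m, a m ≤ b m) (ht : 0 ≤ t) : poissonMix a t ≤ poissonMix b t :=
  (summable ha t).tsum_le_tsum
    (fun m => mul_le_mul_of_nonneg_left (hab m) (by positivity)) (summable hb t)

theorem nonneg {a : ℕ → ℝ} {t : ℝ} (ha : ∀ m, 0 ≤ a m) (ht : 0 ≤ t) : 0 ≤ poissonMix a t :=
  tsum_nonneg fun m => mul_nonneg (by positivity) (ha m)

theorem add {a b : ℕ → ℝ} {C D : ℝ} (ha : ∀ m, |a m| ≤ C) (hb : ∀ m, |b m| ≤ D) (t : ℝ) :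
    poissonMix (fun m => a m + b m) t = poissonMix a t + poissonMix b t := by
  rw [poissonMix, poissonMix, poissonMix, ← (summable ha t).tsum_add (summable hb t)]
  exact tsum_congr fun m => by ring

theorem sub {a b : ℕ → ℝ} {C D : ℝ} (ha : ∀ m, |a m| ≤ C) (hb : ∀ m, |b m| ≤ D) (t : ℝ) :
    poissonMix (fun m => a m - b m) t = poissonMix a t - poissonMix b t := by
  rw [poissonMix, poissonMix, poissonMix, ← (summable ha t).tsum_sub (summable hb t)]
  exact tsum_congr fun m => by ring

theorem const_mul (c : ℝ) (a : ℕ → ℝ) (t : ℝ) :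
    poissonMix (fun m => c * a m) t = c * poissonMix a t := by
  rw [poissonMix, poissonMix, ← tsum_mul_left]
  exact tsum_congr fun m => by ring

theorem sum {ι : Type*} (s : Finset ι) {a : ι → ℕ → ℝ} {C : ℝ} (ha : ∀ i m, |a i m| ≤ C)
    (t : ℝ) : poissonMix (fun m => ∑ i ∈ s, a i m) t = ∑ i ∈ s, poissonMix (a i) t := by
  simp only [poissonMix, Finset.mul_sum]
  exact Summable.tsum_finsetSum fun i _ => summable (ha i) t

theorem geometric (γ t : ℝ) :
    poissonMix (fun m => γ ^ m) t = Real.exp (-((1 - γ) * t)) := by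
  have h : ∑' m : ℕ, t ^ m / m.factorial * γ ^ m = Real.exp (t * γ) := by
    rw [Real.exp_eq_exp_ℝ, NormedSpace.exp_eq_tsum_div]
    exact tsum_congr fun m => by rw [mul_pow]; ring
  rw [eq_exp_mul, h, ← Real.exp_add]
  ring_nf

theorem const (c t : ℝ) : poissonMix (fun _ => c) t = c := by
  have h := const_mul c (fun m => (1 : ℝ) ^ m) t
  rw [geometric] at h
  simpa using h

theorem hasDerivAt {a : ℕ → ℝ} {C : ℝ} (ha : ∀ m, |a m| ≤ C) (t : ℝ) :
    HasDerivAt (poissonMix a) (poissonMix (fun m => a (m + 1) - a m) t) t := by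
  have hC : 0 ≤ C := (abs_nonneg _).trans (ha 0)
  set B : ℝ := |t| + 1 with hB
  have hB0 : 0 ≤ B := by positivity
  have key (m : ℕ) (y : ℝ) :
      ((m + 1 : ℕ) : ℝ) * y ^ (m + 1 - 1) / (m + 1).factorial * a (m + 1)
        = y ^ m / m.factorial * a (m + 1) := by
    have : (m.factorial : ℝ) ≠ 0 := by positivity
    rw [Nat.factorial_succ]
    push_cast
    field_simp
  have hu : Summable fun m : ℕ => (m : ℝ) * B ^ (m - 1) / m.factorial * C := by
    rw [← summable_nat_add_iff 1]
    refine ((Real.summable_pow_div_factorial B).mul_right C).congr fun m => ?_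
    have : (m.factorial : ℝ) ≠ 0 := by positivity
    rw [Nat.factorial_succ]
    push_cast
    field_simp
  have hd : HasDerivAt (fun y => ∑' m : ℕ, y ^ m / m.factorial * a m)
      (∑' m : ℕ, (m : ℝ) * t ^ (m - 1) / m.factorial * a m) t := by
    refine hasDerivAt_tsum_of_isPreconnected (t := Metric.ball 0 B) (y₀ := t) hu
      Metric.isOpen_ball (convex_ball _ _).isPreconnected
      (fun m y _ => ((hasDerivAt_pow m y).div_const _).mul_const _) (fun m y hy => ?_) ?_
      (summable_pow_div ha t) ?_
    · have hy' : |y| ≤ B := by simpa using (mem_ball_zero_iff.1 hy).le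
      rw [norm_mul, norm_div, norm_mul, norm_pow, RCLike.norm_natCast, Real.norm_eq_abs,
        RCLike.norm_natCast]
      gcongr
      exact ha m
    · simp [hB]
    · simp [hB]
  have hs : ∑' m : ℕ, (m : ℝ) * t ^ (m - 1) / m.factorial * a m
      = ∑' m : ℕ, t ^ m / m.factorial * a (m + 1) := by
    have hsum : Summable fun m : ℕ => (m : ℝ) * t ^ (m - 1) / m.factorial * a m := by
      rw [← summable_nat_add_iff 1]
      exact (summable_pow_div (a := fun m => a (m + 1)) (fun m => ha (m + 1)) t).congr
        fun m => (key m t).symm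
    rw [hsum.tsum_eq_zero_add]
    simp only [key]
    simp
  rw [hs] at hd
  have he : HasDerivAt (fun y : ℝ => Real.exp (-y)) (-Real.exp (-t)) t := by
    simpa using (hasDerivAt_neg t).exp
  have := he.mul hd
  rw [sub (C := C) (D := C) (fun m => ha (m + 1)) ha, eq_exp_mul, eq_exp_mul]
  refine (this.congr_deriv ?_).congr_of_eventuallyEq (Eventually.of_forall fun y => ?_)
  · ring
  · rw [eq_exp_mul]
    rfl

/-- Halving the jump probabilities of an operator doubles the time scale. -/
theorem lazy {E : Type*} [AddCommGroup E] [Module ℝ E] (T : Module.End ℝ E) (l : E →ₗ[ℝ] ℝ)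
    (g : E) {C : ℝ} (hC : ∀ m, |l ((T ^ m) g)| ≤ C) (t : ℝ) :
    poissonMix (fun m => l ((((1 / 2 : ℝ) • (1 + T)) ^ m) g)) (2 * t)
      = poissonMix (fun m => l ((T ^ m) g)) t := by
  have h1 := summable_pow_div hC t
  have h2 := Real.summable_pow_div_factorial t
  have h3 := tsum_mul_tsum_eq_tsum_sum_antidiagonal_of_summable_norm h2.norm h1.norm
  have hexp : ∑' m : ℕ, t ^ m / m.factorial = Real.exp t := by
    rw [Real.exp_eq_exp_ℝ, NormedSpace.exp_eq_tsum_div]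
  rw [hexp] at h3
  rw [eq_exp_mul, eq_exp_mul]
  have h4 : ∀ m : ℕ, (2 * t) ^ m / m.factorial * l ((((1 / 2 : ℝ) • (1 + T)) ^ m) g)
      = ∑ kl ∈ Finset.HasAntidiagonal.antidiagonal m,
        t ^ kl.1 / kl.1.factorial * (t ^ kl.2 / kl.2.factorial * l ((T ^ kl.2) g)) := by
    intro m
    have hc : Commute (1 : Module.End ℝ E) T := Commute.one_left T
    rw [_root_.smul_pow, hc.add_pow', LinearMap.smul_apply, map_smul, LinearMap.sum_apply, map_sum,
      smul_eq_mul, Finset.mul_sum, Finset.mul_sum]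
    refine Finset.sum_congr rfl fun kl hkl => ?_
    rw [Finset.HasAntidiagonal.mem_antidiagonal] at hkl
    subst hkl
    rw [one_pow, one_mul, ← Nat.cast_smul_eq_nsmul ℝ, LinearMap.smul_apply, map_smul,
      smul_eq_mul, Nat.choose_symm_add, Nat.add_choose]
    have e1 : ((kl.1 + kl.2).factorial : ℝ) ≠ 0 := by positivity
    have e2 : (kl.1.factorial : ℝ) ≠ 0 := by positivity
    have e3 : (kl.2.factorial : ℝ) ≠ 0 := by positivity
    rw [Nat.cast_div (Nat.factorial_mul_factorial_dvd_factorial_add _ _) (by positivity)]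
    push_cast
    rw [mul_pow, one_div, inv_pow, pow_add t]
    have e4 : (2 : ℝ) ^ (kl.1 + kl.2) ≠ 0 := by positivity
    field_simp
  rw [tsum_congr h4, ← h3, ← mul_assoc, ← Real.exp_add]
  ring_nf

end poissonMix

/-- A linear operator that preserves nonnegative functions and does not increase the constant
function `1`. -/
def IsSubMarkov {ι : Type*} (T : Module.End ℝ (ι → ℝ)) : Prop :=
  (∀ f, 0 ≤ f → 0 ≤ T f) ∧ T 1 ≤ 1

/-- Replace a transition operator by the average of itself and the identity. -/
def lazyOp {E : Type*} [AddCommGroup E] [Module ℝ E] (T : Module.End ℝ E) : Module.End ℝ E :=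
  (1 / 2 : ℝ) • (1 + T)

theorem lazyOp_apply {ι : Type*} (T : Module.End ℝ (ι → ℝ)) (f : ι → ℝ) (x : ι) :
    lazyOp T f x = (f x + T f x) / 2 := by
  simp [lazyOp]
  ring

namespace IsSubMarkov

variable {ι : Type*} {T : Module.End ℝ (ι → ℝ)}

theorem mono (hT : IsSubMarkov T) {f g : ι → ℝ} (h : f ≤ g) : T f ≤ T g := by
  have := hT.1 (g - f) (sub_nonneg.2 h)
  rwa [map_sub, sub_nonneg] at this

theorem pow_mono (hT : IsSubMarkov T) {f g : ι → ℝ} (h : f ≤ g) (m : ℕ) :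
    (T ^ m) f ≤ (T ^ m) g := by
  induction m with
  | zero => simpa
  | succ m ih => simpa only [pow_succ', Module.End.mul_apply] using hT.mono ih

theorem pow_nonneg (hT : IsSubMarkov T) {f : ι → ℝ} (h : 0 ≤ f) (m : ℕ) : 0 ≤ (T ^ m) f := by
  simpa using hT.pow_mono h m

theorem pow_one_le (hT : IsSubMarkov T) (m : ℕ) : (T ^ m) 1 ≤ 1 := by
  induction m with
  | zero => simp
  | succ m ih =>
    rw [pow_succ', Module.End.mul_apply]
    exact (hT.mono ih).trans hT.2

theorem pow_le (hT : IsSubMarkov T) {f : ι → ℝ} {B : ℝ} (hB : 0 ≤ B) (h : ∀ x, f x ≤ B)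
    (m : ℕ) (x : ι) : (T ^ m) f x ≤ B := by
  have h1 : f ≤ B • (1 : ι → ℝ) := fun y => by simpa using h y
  have h2 := hT.pow_mono h1 m x
  rw [map_smul] at h2
  have h3 := mul_le_mul_of_nonneg_left (hT.pow_one_le m x) hB
  simp only [Pi.smul_apply, smul_eq_mul, Pi.one_apply, mul_one] at h2 h3
  linarith

theorem abs_pow_le (hT : IsSubMarkov T) {f : ι → ℝ} {B : ℝ} (hB : ∀ x, |f x| ≤ B)
    (m : ℕ) (x : ι) : |(T ^ m) f x| ≤ B := by
  have h0 : 0 ≤ B := (abs_nonneg _).trans (hB x)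
  refine abs_le.2 ⟨?_, hT.pow_le h0 (fun y => (abs_le.1 (hB y)).2) m x⟩
  have := hT.pow_le (f := -f) h0 (fun y => by simpa using neg_le.1 (abs_le.1 (hB y)).1) m x
  rw [map_neg, Pi.neg_apply] at this
  linarith

theorem lazy (hT : IsSubMarkov T) : IsSubMarkov (lazyOp T) := by
  refine ⟨fun f hf x => ?_, fun x => ?_⟩
  · have h1 := hT.1 f hf x
    have h2 := hf x
    rw [lazyOp_apply]
    simp only [Pi.zero_apply] at *
    linarith
  · have h1 := hT.2 x
    rw [lazyOp_apply]
    simp only [Pi.one_apply] at *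
    linarith

end IsSubMarkov

/-- The tridiagonal operator with upward rates `p`, downward rates `q` and diagonal `r`. -/
def tridiagOp (p q r : ℕ → ℝ) : Module.End ℝ (ℕ → ℝ) where
  toFun f x := q x * f (x - 1) + r x * f x + p x * f (x + 1)
  map_add' f g := by
    ext x
    simp only [Pi.add_apply]
    ring
  map_smul' a f := by
    ext x
    simp only [Pi.smul_apply, smul_eq_mul, RingHom.id_apply]
    ring

theorem tridiagOp_apply (p q r f : ℕ → ℝ) (x : ℕ) :
    tridiagOp p q r f x = q x * f (x - 1) + r x * f x + p x * f (x + 1) := rfl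

/-- A tridiagonal operator with constant row sums `θ` preserves monotonicity as soon as
`p x + q (x + 1) ≤ θ`. -/
theorem tridiagOp_antitone {p q r : ℕ → ℝ} {N : ℕ} {θ : ℝ} (hp : ∀ x ≤ N, 0 ≤ p x)
    (hq : ∀ x ≤ N, 0 ≤ q x) (hpN : p N = 0)
    (hsum : ∀ x ≤ N, q x + r x + p x = θ) (hlazy : ∀ x < N, p x + q (x + 1) ≤ θ)
    {f : ℕ → ℝ} (hf : ∀ x < N, f (x + 1) ≤ f x) (x : ℕ) (hx : x < N) :
    tridiagOp p q r f (x + 1) ≤ tridiagOp p q r f x := by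
  rw [tridiagOp_apply, tridiagOp_apply, Nat.add_sub_cancel]
  have h1 : 0 ≤ q x * (f (x - 1) - f x) := by
    rcases Nat.eq_zero_or_pos x with rfl | h0
    · simp
    · have := hf (x - 1) (by omega)
      rw [Nat.sub_add_cancel h0] at this
      exact mul_nonneg (hq x hx.le) (by linarith)
  have h2 : 0 ≤ p (x + 1) * (f (x + 1) - f (x + 1 + 1)) := by
    rcases Nat.lt_or_ge (x + 1) N with h0 | h0
    · exact mul_nonneg (hp _ hx) (sub_nonneg.2 (hf _ h0))
    · rw [show x + 1 = N by omega, hpN, zero_mul]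
  have h3 : 0 ≤ (θ - p x - q (x + 1)) * (f x - f (x + 1)) :=
    mul_nonneg (by linarith [hlazy x hx]) (sub_nonneg.2 (hf x hx))
  have h4 : r x = θ - q x - p x := by linarith [hsum x hx.le]
  have h5 : r (x + 1) = θ - q (x + 1) - p (x + 1) := by linarith [hsum (x + 1) hx]
  rw [h4, h5]
  nlinarith

/-- The indicator function of `{0, ..., M-1}`. -/
def below (M x : ℕ) : ℝ := if x < M then 1 else 0

theorem below_nonneg (M : ℕ) : 0 ≤ below M := fun x => by
  unfold below
  split_ifs <;> simp

theorem below_le_one (M x : ℕ) : below M x ≤ 1 := by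
  unfold below
  split_ifs <;> simp

theorem abs_below_le (M x : ℕ) : |below M x| ≤ 1 :=
  abs_le.2 ⟨by linarith [below_nonneg M x, show (0 : ℕ → ℝ) x = 0 from rfl], below_le_one M x⟩

namespace BDChain

variable {n : ℕ} (c : BDChain n)

/-- The entries of the transition matrix, extended by zero. -/
def entry (x y : ℕ) : ℝ :=
  if h : x < n + 1 ∧ y < n + 1 then c.K ⟨x, h.1⟩ ⟨y, h.2⟩ else 0

/-- The upward transition probability. -/
def up (x : ℕ) : ℝ := c.entry x (x + 1)

/-- The downward transition probability. -/
def down (x : ℕ) : ℝ := if x = 0 then 0 else c.entry x (x - 1)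

/-- The holding probability. -/
def stay (x : ℕ) : ℝ := c.entry x x

/-- The stationary distribution, extended by zero. -/
def weight (x : ℕ) : ℝ := if h : x < n + 1 then c.pi ⟨x, h⟩ else 0

/-- The transition operator on functions. -/
def op : Module.End ℝ (ℕ → ℝ) := tridiagOp c.up c.down c.stay

/-- The transition operator of the chain killed outside `{0, ..., M-1}`. -/
def killedOp (M : ℕ) : Module.End ℝ (ℕ → ℝ) where
  toFun f x := if x < M then c.op f x else 0
  map_add' f g := by
    ext x
    simp only [map_add, Pi.add_apply]
    split_ifs <;> simp
  map_smul' a f := by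
    ext x
    simp only [map_smul, Pi.smul_apply, smul_eq_mul, RingHom.id_apply]
    split_ifs <;> simp

theorem killedOp_apply (M : ℕ) (f : ℕ → ℝ) (x : ℕ) :
    c.killedOp M f x = if x < M then c.op f x else 0 := rfl

theorem op_apply (f : ℕ → ℝ) (x : ℕ) :
    c.op f x = c.down x * f (x - 1) + c.stay x * f x + c.up x * f (x + 1) := rfl

theorem entry_nonneg (x y : ℕ) : 0 ≤ c.entry x y := by
  unfold entry
  split_ifs
  · exact c.K_nonneg _ _
  · exact le_rfl

theorem entry_fin (i j : Fin (n + 1)) : c.entry i j = c.K i j :=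
  dif_pos ⟨i.2, j.2⟩

theorem weight_fin (i : Fin (n + 1)) : c.weight i = c.pi i :=
  dif_pos i.2

theorem up_nonneg (x : ℕ) : 0 ≤ c.up x := c.entry_nonneg _ _

theorem stay_nonneg (x : ℕ) : 0 ≤ c.stay x := c.entry_nonneg _ _

theorem down_nonneg (x : ℕ) : 0 ≤ c.down x := by
  unfold down
  split_ifs
  exacts [le_rfl, c.entry_nonneg _ _]

theorem down_zero : c.down 0 = 0 := by simp [down]

theorem down_succ (x : ℕ) : c.down (x + 1) = c.entry (x + 1) x := by simp [down]

theorem weight_nonneg (x : ℕ) : 0 ≤ c.weight x := by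
  unfold weight
  split_ifs
  · exact (c.pi_pos _).le
  · exact le_rfl

theorem weight_pos {x : ℕ} (hx : x ≤ n) : 0 < c.weight x := by
  rw [weight, dif_pos (by omega)]
  exact c.pi_pos _

theorem up_pos {x : ℕ} (hx : x < n) : 0 < c.up x := by
  rw [up, entry, dif_pos (by omega)]
  exact (c.K_irred x hx).1

theorem down_pos {x : ℕ} (hx : x < n) : 0 < c.down (x + 1) := by
  rw [down_succ, entry, dif_pos (by omega)]
  exact (c.K_irred x hx).2

theorem up_last : c.up n = 0 := by simp [up, entry]

theorem entry_eq_zero_of_lt {x y : ℕ} (h : n < x) : c.entry x y = 0 :=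
  dif_neg (by omega)

theorem entry_eq_zero_of_far {x y : ℕ} (h : x + 1 < y ∨ y + 1 < x) : c.entry x y = 0 := by
  unfold entry
  split_ifs with h'
  · refine c.K_tridiag _ _ ?_
    rw [lt_abs]
    simp only
    omega
  · rfl

/-- A sum against a function supported on the neighbours of `x` has at most three terms. -/
theorem sum_range_eq_of_tridiag {N : ℕ} (g : ℕ → ℝ) {x : ℕ} (hx : x ≤ N)
    (hg : ∀ y, x + 1 < y ∨ y + 1 < x → g y = 0) (hN : g (N + 1) = 0) :
    ∑ y ∈ Finset.range (N + 1), g y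
      = (if x = 0 then 0 else g (x - 1)) + g x + g (x + 1) := by
  have h1 : ∑ y ∈ Finset.range (N + 1), g y = ∑ y ∈ Finset.range (N + 2), g y := by
    rw [Finset.sum_range_succ _ (N + 1), hN, add_zero]
  rw [h1]
  rcases Nat.eq_zero_or_pos x with rfl | h0
  · have hs : ({0, 1} : Finset ℕ) ⊆ Finset.range (N + 2) := by
      intro y hy
      simp at hy ⊢
      omega
    rw [← Finset.sum_subset hs]
    · simp
    · intro y _ hy
      refine hg y ?_
      simp at hy
      omega
  · obtain ⟨k, rfl⟩ : ∃ k, x = k + 1 := ⟨x - 1, by omega⟩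
    have hs : ({k, k + 1, k + 2} : Finset ℕ) ⊆ Finset.range (N + 2) := by
      intro y hy
      simp at hy ⊢
      omega
    rw [← Finset.sum_subset hs]
    · rw [Finset.sum_insert (by simp), Finset.sum_insert (by simp), Finset.sum_singleton]
      simp [add_assoc]
    · intro y _ hy
      refine hg y ?_
      simp at hy
      omega

theorem sum_K_mul (i : Fin (n + 1)) (f : ℕ → ℝ) : ∑ j, c.K i j * f j = c.op f i := by
  have h1 : ∑ j, c.K i j * f j = ∑ y ∈ Finset.range (n + 1), c.entry i y * f y := by
    rw [← Fin.sum_univ_eq_sum_range (fun y => c.entry i y * f y)]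
    exact Finset.sum_congr rfl fun j _ => by rw [entry_fin]
  rw [h1, sum_range_eq_of_tridiag (fun y => c.entry i y * f y) (x := i) (by omega)
    (fun y hy => by simp only [c.entry_eq_zero_of_far hy, zero_mul]) (by simp [entry]), op_apply,
    down]
  split_ifs <;> simp [up, stay]

theorem rates_sum {x : ℕ} (hx : x ≤ n) : c.down x + c.stay x + c.up x = 1 := by
  have h := c.sum_K_mul ⟨x, by omega⟩ 1
  simp only [Pi.one_apply, mul_one, c.K_rowSum, op_apply] at h
  exact h.symm

theorem rates_of_gt {x : ℕ} (hx : n < x) : c.down x = 0 ∧ c.stay x = 0 ∧ c.up x = 0 := by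
  simp [down, stay, up, c.entry_eq_zero_of_lt hx]

theorem isSubMarkov_op : IsSubMarkov c.op := by
  refine ⟨fun f hf x => ?_, fun x => ?_⟩
  · rw [op_apply]
    have := mul_nonneg (c.down_nonneg x) (hf (x - 1))
    have := mul_nonneg (c.stay_nonneg x) (hf x)
    have := mul_nonneg (c.up_nonneg x) (hf (x + 1))
    simp only [Pi.zero_apply]
    linarith
  · rw [op_apply]
    simp only [Pi.one_apply, mul_one]
    rcases Nat.lt_or_ge n x with hx | hx
    · obtain ⟨h1, h2, h3⟩ := c.rates_of_gt hx
      simp [h1, h2, h3]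
    · exact (c.rates_sum hx).le

theorem isSubMarkov_killedOp (M : ℕ) : IsSubMarkov (c.killedOp M) := by
  refine ⟨fun f hf x => ?_, fun x => ?_⟩
  · rw [killedOp_apply]
    split_ifs
    exacts [c.isSubMarkov_op.1 f hf x, le_rfl]
  · rw [killedOp_apply]
    split_ifs
    exacts [c.isSubMarkov_op.2 x, zero_le_one]

theorem detailed_balance {x : ℕ} (hx : x < n) :
    c.weight x * c.up x = c.weight (x + 1) * c.down (x + 1) := by
  have stat (x : ℕ) (hx : x ≤ n) :
      (if x = 0 then 0 else c.weight (x - 1) * c.up (x - 1)) + c.weight x * c.stay x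
        + c.weight (x + 1) * c.down (x + 1) = c.weight x := by
    have h1 := c.pi_stat ⟨x, by omega⟩
    have h2 : ∑ i, c.pi i * c.K i ⟨x, by omega⟩
        = ∑ y ∈ Finset.range (n + 1), c.weight y * c.entry y x := by
      rw [← Fin.sum_univ_eq_sum_range (fun y => c.weight y * c.entry y x)]
      exact Finset.sum_congr rfl fun j _ => by
        rw [weight_fin, ← c.entry_fin]
    rw [h2, sum_range_eq_of_tridiag (fun y => c.weight y * c.entry y x) (x := x) hx
      (fun y hy => by simp only [c.entry_eq_zero_of_far hy.symm, mul_zero])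
      (by simp [weight]), ← c.weight_fin] at h1
    refine Eq.trans ?_ h1
    rw [down_succ, stay]
    rcases Nat.eq_zero_or_pos x with rfl | h0
    · simp
    · rw [if_neg h0.ne', if_neg h0.ne', up, Nat.sub_add_cancel h0]
  induction x with
  | zero =>
    have h1 := stat 0 (by omega)
    have h2 := c.rates_sum (x := 0) (by omega)
    rw [down_zero] at h2
    simp only [if_true] at h1
    linear_combination c.weight 0 * h2 - h1
  | succ x ih =>
    have h1 := stat (x + 1) (by omega)
    have h2 := c.rates_sum (x := x + 1) (by omega)
    have h3 := ih (by omega)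
    rw [if_neg (by omega), Nat.add_sub_cancel] at h1
    linear_combination c.weight (x + 1) * h2 - h1 + h3

end BDChain

namespace BDChain

variable {n : ℕ} (c : BDChain n)

/-- `P_0(τ̃_M > t)`, for a state `M` given as a natural number. -/
def surv (M : ℕ) (t : ℝ) : ℝ :=
  poissonMix (fun m => ((c.killedOp M) ^ m) (below M) 0) t

/-- `P_0(X_{N_t} < k)`. -/
def cdf (k : ℕ) (t : ℝ) : ℝ := poissonMix (fun m => (c.op ^ m) (below k) 0) t

/-- `π([0, k))`. -/
def low (k : ℕ) : ℝ := ∑ x ∈ Finset.range k, c.weight x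

theorem killedOp_pow_of_le {M : ℕ} {f : ℕ → ℝ} (hf : ∀ x, M ≤ x → f x = 0) (m : ℕ) {x : ℕ}
    (hx : M ≤ x) : ((c.killedOp M) ^ m) f x = 0 := by
  cases m with
  | zero => simpa using hf x hx
  | succ m => rw [pow_succ', Module.End.mul_apply, killedOp_apply, if_neg (by omega)]

theorem below_of_le {M x : ℕ} (hx : M ≤ x) : below M x = 0 := if_neg (by omega)

theorem below_of_lt {M x : ℕ} (hx : x < M) : below M x = 1 := if_pos hx

theorem K_pow_mulVec (f : ℕ → ℝ) (m : ℕ) (i : Fin (n + 1)) :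
    ((c.K ^ m) *ᵥ fun j => f j) i = (c.op ^ m) f i := by
  induction m generalizing i with
  | zero => simp
  | succ m ih =>
    rw [pow_succ', ← mulVec_mulVec, funext ih, pow_succ', Module.End.mul_apply, ← sum_K_mul]
    rfl

theorem K_pow_apply (m : ℕ) (i j : Fin (n + 1)) :
    (c.K ^ m) i j = (c.op ^ m) (Pi.single (j : ℕ) 1) i := by
  rw [← K_pow_mulVec, mulVec, dotProduct, Finset.sum_eq_single j]
  · simp
  · intro k _ hk
    rw [Pi.single_eq_of_ne (by simpa [Fin.ext_iff] using hk), mul_zero]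
  · simp

theorem killed_pow_mulVec (M : Fin (n + 1)) (m : ℕ) (i : Fin (n + 1)) (hi : i < M) :
    ((c.killed M ^ m) *ᵥ 1) i = ((c.killedOp M) ^ m) (below M) i := by
  induction m generalizing i with
  | zero => simp [below_of_lt (Fin.lt_def.1 hi)]
  | succ m ih =>
    rw [pow_succ', ← mulVec_mulVec, pow_succ', Module.End.mul_apply, killedOp_apply,
      if_pos (Fin.lt_def.1 hi), ← sum_K_mul, mulVec, dotProduct]
    refine Finset.sum_congr rfl fun j _ => ?_
    rcases lt_trichotomy j M with hj | rfl | hj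
    · rw [ih j hj]
      simp [killed, hi.ne, hj.ne]
    · rw [c.killedOp_pow_of_le (fun x hx => below_of_le hx) m le_rfl]
      simp [killed]
    · have : c.K i j = 0 := by
        rw [← entry_fin]
        exact c.entry_eq_zero_of_far
          (Or.inl (by have := Fin.lt_def.1 hi; have := Fin.lt_def.1 hj; omega))
      simp [killed, this]

theorem hitSurvC_eq (M : Fin (n + 1)) (t : ℝ) : c.hitSurvC M 0 t = c.surv M t := by
  unfold hitSurvC surv poissonMix
  refine tsum_congr fun m => ?_
  congr 1
  rw [hitSurv]
  split_ifs with h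
  · subst h
    exact (c.killedOp_pow_of_le (M := 0) (fun x hx => below_of_le hx) m le_rfl).symm
  · have h0 : (0 : Fin (n + 1)) < M := Fin.pos_iff_ne_zero.2 (Ne.symm h)
    have h1 := c.killed_pow_mulVec M m 0 h0
    simp only [mulVec, dotProduct, mul_one, Fin.val_zero, Pi.one_apply] at h1
    exact h1

theorem abs_op_pow_le (m : ℕ) (k x : ℕ) : |(c.op ^ m) (below k) x| ≤ 1 :=
  c.isSubMarkov_op.abs_pow_le (abs_below_le k) m x

theorem abs_killedOp_pow_le (M m x : ℕ) : |((c.killedOp M) ^ m) (below M) x| ≤ 1 :=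
  (c.isSubMarkov_killedOp M).abs_pow_le (abs_below_le M) m x

theorem abs_single_le (y x : ℕ) : |(Pi.single y 1 : ℕ → ℝ) x| ≤ 1 := by
  rcases eq_or_ne x y with rfl | h
  · simp
  · simp [h]

theorem Ht_eq (t : ℝ) (x y : Fin (n + 1)) :
    c.Ht t x y = poissonMix (fun m => (c.op ^ m) (Pi.single (y : ℕ) 1) x) t :=
  tsum_congr fun m => by rw [c.K_pow_apply]

theorem below_eq_sum (k : ℕ) :
    below k = ∑ y ∈ Finset.range k, (Pi.single y 1 : ℕ → ℝ) := by
  ext x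
  rw [Finset.sum_apply]
  simp [below, Pi.single_apply]

theorem cdf_eq_sum (k : ℕ) (t : ℝ) :
    c.cdf k t = ∑ y ∈ Finset.range k, poissonMix (fun m => (c.op ^ m) (Pi.single y 1) 0) t := by
  have h := poissonMix.sum (Finset.range k) (a := fun y m => (c.op ^ m) (Pi.single y 1) 0) (C := 1)
    (fun i m => c.isSubMarkov_op.abs_pow_le (abs_single_le i) m 0) t
  rw [← h, cdf]
  simp only [below_eq_sum, map_sum, Finset.sum_apply]

/-- The inner product with respect to the stationary distribution. -/
def dot (f g : ℕ → ℝ) : ℝ := ∑ x ∈ Finset.range (n + 1), c.weight x * (f x * g x)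

theorem dot_op (f g : ℕ → ℝ) : c.dot f (c.op g) = c.dot (c.op f) g := by
  have key (f g : ℕ → ℝ) :
      ∑ x ∈ Finset.range (n + 1), c.weight x * (f x * (c.up x * g (x + 1)))
        = ∑ x ∈ Finset.range (n + 1), c.weight x * (c.down x * f (x - 1) * g x) := by
    rw [Finset.sum_range_succ, Finset.sum_range_succ', c.up_last, c.down_zero]
    simp only [zero_mul, mul_zero, add_zero]
    refine Finset.sum_congr rfl fun x hx => ?_
    have := c.detailed_balance (Finset.mem_range.1 hx)
    rw [Nat.add_sub_cancel]
    linear_combination (f x * g (x + 1)) * this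
  have h1 := key f g
  have h2 := key g f
  have h3 : c.dot f (c.op g) = ∑ x ∈ Finset.range (n + 1), c.weight x * (c.down x * g (x - 1) * f x)
      + ∑ x ∈ Finset.range (n + 1), c.weight x * (f x * (c.stay x * g x))
      + ∑ x ∈ Finset.range (n + 1), c.weight x * (f x * (c.up x * g (x + 1))) := by
    rw [dot, ← Finset.sum_add_distrib, ← Finset.sum_add_distrib]
    exact Finset.sum_congr rfl fun x _ => by rw [op_apply]; ring
  have h4 : c.dot (c.op f) g = ∑ x ∈ Finset.range (n + 1), c.weight x * (c.down x * f (x - 1) * g x)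
      + ∑ x ∈ Finset.range (n + 1), c.weight x * (f x * (c.stay x * g x))
      + ∑ x ∈ Finset.range (n + 1), c.weight x * (g x * (c.up x * f (x + 1))) := by
    rw [dot, ← Finset.sum_add_distrib, ← Finset.sum_add_distrib]
    exact Finset.sum_congr rfl fun x _ => by rw [op_apply]; ring
  rw [h3, h4]
  linarith

theorem dot_lazy (f g : ℕ → ℝ) : c.dot f (lazyOp c.op g) = c.dot (lazyOp c.op f) g := by
  have h (f g : ℕ → ℝ) : c.dot f (lazyOp c.op g) = (c.dot f g + c.dot f (c.op g)) / 2 := by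
    simp only [dot, ← Finset.sum_add_distrib, Finset.sum_div]
    exact Finset.sum_congr rfl fun x _ => by rw [lazyOp_apply]; ring
  have hc (f g : ℕ → ℝ) : c.dot f g = c.dot g f := by
    simp only [dot, mul_comm (f _)]
  rw [h, hc (lazyOp c.op f), h, dot_op, hc g f, hc g]

theorem dot_lazy_pow (f g : ℕ → ℝ) (m : ℕ) :
    c.dot f ((lazyOp c.op ^ m) g) = c.dot ((lazyOp c.op ^ m) f) g := by
  induction m generalizing f with
  | zero => simp
  | succ m ih =>
    rw [pow_succ', Module.End.mul_apply, dot_lazy, ih, ← Module.End.mul_apply, ← pow_succ,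
      ← pow_succ']

theorem lazy_pow_one (m : ℕ) {x : ℕ} (hx : x ≤ n) : (lazyOp c.op ^ m) 1 x = 1 := by
  induction m generalizing x with
  | zero => simp
  | succ m ih =>
    have h0 := ih (x := x - 1) (by omega)
    rw [pow_succ', Module.End.mul_apply, lazyOp_apply, op_apply, ih hx, h0]
    rcases Nat.lt_or_ge x n with h | h
    · rw [ih (x := x + 1) h]
      linarith [c.rates_sum hx]
    · obtain rfl : x = n := by omega
      have := c.rates_sum hx
      rw [c.up_last] at *
      linarith

theorem sum_weight_lazy_pow (f : ℕ → ℝ) (m : ℕ) :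
    ∑ x ∈ Finset.range (n + 1), c.weight x * (lazyOp c.op ^ m) f x
      = ∑ x ∈ Finset.range (n + 1), c.weight x * f x := by
  have h := c.dot_lazy_pow 1 f m
  simp only [dot] at h
  convert h using 2 with x hx x hx
  · simp
  · rw [c.lazy_pow_one m (by simpa [Nat.lt_succ_iff] using hx)]
    simp

theorem lazy_pow_single_symm (m : ℕ) {x y : ℕ} (hx : x ≤ n) (hy : y ≤ n) :
    c.weight x * (lazyOp c.op ^ m) (Pi.single y 1) x
      = c.weight y * (lazyOp c.op ^ m) (Pi.single x 1) y := by
  have h := c.dot_lazy_pow (Pi.single x 1) (Pi.single y 1) m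
  rw [dot, dot, Finset.sum_eq_single x, Finset.sum_eq_single y] at h
  · simpa using h
  · intro b _ hb
    simp [hb]
  · intro h
    simp at h
    omega
  · intro b _ hb
    simp [hb]
  · intro h
    simp at h
    omega

theorem lazyOp_eq_tridiagOp :
    lazyOp c.op = tridiagOp (fun x => c.up x / 2) (fun x => c.down x / 2)
      (fun x => (1 + c.stay x) / 2) := by
  ext f x
  rw [lazyOp_apply, op_apply, tridiagOp_apply]
  ring

theorem lazy_pow_antitone {f : ℕ → ℝ} (hf : ∀ x < n, f (x + 1) ≤ f x) (m : ℕ) :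
    ∀ x < n, (lazyOp c.op ^ m) f (x + 1) ≤ (lazyOp c.op ^ m) f x := by
  induction m with
  | zero => simpa using hf
  | succ m ih =>
    rw [pow_succ', Module.End.mul_apply]
    intro x hx
    rw [c.lazyOp_eq_tridiagOp] at ih ⊢
    refine tridiagOp_antitone (N := n) (θ := 1) (fun x _ => ?_) (fun x _ => ?_) ?_
      (fun x hx => ?_) (fun x hx => ?_) ih x hx
    · linarith [c.up_nonneg x]
    · linarith [c.down_nonneg x]
    · simp [c.up_last]
    · linarith [c.rates_sum hx]
    · linarith [c.rates_sum hx.le, c.rates_sum (Nat.succ_le_of_lt hx), c.down_nonneg x,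
        c.stay_nonneg x, c.stay_nonneg (x + 1), c.up_nonneg (x + 1)]

theorem le_of_antitone {f : ℕ → ℝ} (hf : ∀ x < n, f (x + 1) ≤ f x) {x y : ℕ} (hxy : x ≤ y)
    (hy : y ≤ n) : f y ≤ f x := by
  induction y, hxy using Nat.le_induction with
  | base => exact le_rfl
  | succ y _ ih => exact (hf y hy).trans (ih (by omega))

theorem low_nonneg (k : ℕ) : 0 ≤ c.low k := Finset.sum_nonneg fun x _ => c.weight_nonneg x

theorem low_mono {k l : ℕ} (h : k ≤ l) : c.low k ≤ c.low l :=
  Finset.sum_le_sum_of_subset_of_nonneg (Finset.range_mono h) fun x _ _ => c.weight_nonneg x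

theorem low_pos (k : ℕ) : 0 < c.low (k + 1) := by
  refine lt_of_lt_of_le ?_ (c.low_mono (k := 1) (by omega))
  simpa [low] using c.weight_pos (Nat.zero_le n)

theorem low_last : c.low (n + 1) = 1 := by
  rw [low, ← Fin.sum_univ_eq_sum_range, ← c.pi_sum]
  exact Finset.sum_congr rfl fun x _ => c.weight_fin x

theorem low_le_one (k : ℕ) : c.low k ≤ 1 := by
  rcases Nat.le_total k (n + 1) with h | h
  · exact (c.low_mono h).trans c.low_last.le
  · rw [← c.low_last, low, low]
    refine (Finset.sum_subset (Finset.range_mono h) fun x _ hx => ?_).ge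
    simp at hx
    simp [weight]
    omega

theorem low_eq (k : ℕ) (hk : k ≤ n + 1) :
    ∑ x ∈ Finset.range (n + 1), c.weight x * below k x = c.low k := by
  rw [low, ← Finset.sum_subset (Finset.range_mono hk)]
  · exact Finset.sum_congr rfl fun x hx => by rw [below_of_lt (by simpa using hx), mul_one]
  · intro x _ hx
    rw [below_of_le (by simpa using hx), mul_zero]

theorem below_antitone (k x : ℕ) : below k (x + 1) ≤ below k x := by
  unfold below
  split_ifs <;> first | simp | omega

/-- Starting from `Q`, the chain is below `k` with probability at most `π([0,k)) / π([0,Q])`. -/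
theorem lazy_pow_below_le {k Q : ℕ} (hk : k ≤ n + 1) (hQ : Q ≤ n) (m : ℕ) :
    (lazyOp c.op ^ m) (below k) Q ≤ c.low k / c.low (Q + 1) := by
  rw [le_div_iff₀ (c.low_pos Q), ← c.low_eq k hk, ← c.sum_weight_lazy_pow _ m, low,
    Finset.mul_sum]
  have ha := c.lazy_pow_antitone (fun x _ => below_antitone k x) m
  have hn := c.isSubMarkov_op.lazy.pow_nonneg (below_nonneg k) m
  calc _ ≤ ∑ x ∈ Finset.range (Q + 1), c.weight x * (lazyOp c.op ^ m) (below k) x := by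
        refine Finset.sum_le_sum fun x hx => ?_
        rw [mul_comm]
        refine mul_le_mul_of_nonneg_left ?_ (c.weight_nonneg x)
        exact le_of_antitone ha (by simpa [Nat.lt_succ_iff] using hx) hQ
    _ ≤ _ := Finset.sum_le_sum_of_subset_of_nonneg (Finset.range_mono (by omega))
        fun x _ _ => mul_nonneg (c.weight_nonneg x) (hn x)

/-- Up to the hitting time of `Q` the chain agrees with the killed chain. -/
theorem lazy_pow_le_killed {f : ℕ → ℝ} {Q : ℕ} {b : ℝ} (hf : ∀ x, f x ≤ 1) (hb : 0 ≤ b)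
    (hfb : ∀ m, (lazyOp c.op ^ m) f Q ≤ b) (hQ : Q ≤ n) (m x : ℕ) (hx : x ≤ Q) :
    (lazyOp c.op ^ m) f x ≤ (lazyOp (c.killedOp Q) ^ m) (below Q) x + b := by
  rcases hx.eq_or_lt with rfl | hlt
  · linarith [hfb m, (c.isSubMarkov_killedOp x).lazy.pow_nonneg (below_nonneg x) m x,
      show (0 : ℕ → ℝ) x = 0 from rfl]
  induction m generalizing x with
  | zero =>
    simp only [pow_zero, Module.End.one_apply, below_of_lt hlt]
    linarith [hf x]
  | succ m ih =>
    have ih' : ∀ y ≤ Q, (lazyOp c.op ^ m) f y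
        ≤ (lazyOp (c.killedOp Q) ^ m) (below Q) y + b := by
      intro y hy
      rcases hy.eq_or_lt with rfl | hy'
      · linarith [hfb m, (c.isSubMarkov_killedOp y).lazy.pow_nonneg (below_nonneg y) m y,
          show (0 : ℕ → ℝ) y = 0 from rfl]
      · exact ih y hy hy'
    rw [pow_succ', Module.End.mul_apply, lazyOp_apply, pow_succ', Module.End.mul_apply,
      lazyOp_apply, killedOp_apply, if_pos hlt, op_apply, op_apply]
    have h1 := mul_le_mul_of_nonneg_left (ih' (x - 1) (by omega)) (c.down_nonneg x)
    have h2 := mul_le_mul_of_nonneg_left (ih' x hx) (c.stay_nonneg x)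
    have h3 := mul_le_mul_of_nonneg_left (ih' (x + 1) hlt) (c.up_nonneg x)
    have h4 := c.rates_sum (hx.trans hQ)
    have h5 := ih' x hx
    have h6 : b = c.down x * b + c.stay x * b + c.up x * b := by
      rw [← add_mul, ← add_mul, h4, one_mul]
    linarith

theorem surv_eq_lazy (M : ℕ) (t : ℝ) :
    c.surv M t = poissonMix (fun m => (lazyOp (c.killedOp M) ^ m) (below M) 0) (2 * t) :=
  (poissonMix.lazy (c.killedOp M) (LinearMap.proj (R := ℝ) (φ := fun _ : ℕ => ℝ) 0) (below M)
    (fun m => c.abs_killedOp_pow_le M m 0) t).symm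

theorem op_eq_lazy {f : ℕ → ℝ} (hf : ∀ x, |f x| ≤ 1) (x : ℕ) (t : ℝ) :
    poissonMix (fun m => (c.op ^ m) f x) t
      = poissonMix (fun m => (lazyOp c.op ^ m) f x) (2 * t) :=
  (poissonMix.lazy c.op (LinearMap.proj (R := ℝ) (φ := fun _ : ℕ => ℝ) x) f
    (fun m => c.isSubMarkov_op.abs_pow_le hf m x) t).symm

theorem surv_nonneg (M : ℕ) {t : ℝ} (ht : 0 ≤ t) : 0 ≤ c.surv M t :=
  poissonMix.nonneg
    (fun m => (c.isSubMarkov_killedOp M).pow_nonneg (below_nonneg M) m 0) ht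

theorem surv_le_one (M : ℕ) {t : ℝ} (ht : 0 ≤ t) : c.surv M t ≤ 1 := by
  refine (poissonMix.mono (b := fun _ => 1) (D := 1) (c.abs_killedOp_pow_le M · 0) (by simp)
    (fun m => (abs_le.1 (c.abs_killedOp_pow_le M m 0)).2) ht).trans_eq (poissonMix.const 1 t)

theorem cdf_le_one (k : ℕ) {t : ℝ} (ht : 0 ≤ t) : c.cdf k t ≤ 1 := by
  refine (poissonMix.mono (b := fun _ => 1) (D := 1) (c.abs_op_pow_le · k 0) (by simp)
    (fun m => (abs_le.1 (c.abs_op_pow_le m k 0)).2) ht).trans_eq (poissonMix.const 1 t)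

theorem cdf_le {k Q : ℕ} (hk : k ≤ n + 1) (hQ : Q ≤ n) {t : ℝ} (ht : 0 ≤ t) :
    c.cdf k t ≤ c.surv Q t + c.low k / c.low (Q + 1) := by
  have hb : 0 ≤ c.low k / c.low (Q + 1) := div_nonneg (c.low_nonneg _) (c.low_nonneg _)
  have h1 := (c.isSubMarkov_killedOp Q).lazy.abs_pow_le (abs_below_le Q)
  have h2 := c.isSubMarkov_op.lazy.abs_pow_le (abs_below_le k)
  rw [cdf, c.op_eq_lazy (abs_below_le k), surv_eq_lazy,
    ← poissonMix.const (c.low k / c.low (Q + 1)) (2 * t),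
    ← poissonMix.add (C := 1) (D := c.low k / c.low (Q + 1)) (h1 · 0) (by simp [abs_of_nonneg hb])]
  refine poissonMix.mono (C := 1) (D := 1 + c.low k / c.low (Q + 1)) (h2 · 0) (fun m => ?_)
    (fun m => ?_) (by linarith)
  · exact (abs_add_le _ _).trans (add_le_add (h1 m 0) (abs_of_nonneg hb).le)
  · exact c.lazy_pow_le_killed (below_le_one k) hb (fun m => c.lazy_pow_below_le hk hQ m) hQ m 0
      (Nat.zero_le _)

theorem surv_le_cdf (M : ℕ) {t : ℝ} (ht : 0 ≤ t) : c.surv M t ≤ c.cdf M t := by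
  refine poissonMix.mono (c.abs_killedOp_pow_le M · 0) (c.abs_op_pow_le · M 0) (fun m => ?_) ht
  have h (m : ℕ) : ((c.killedOp M) ^ m) (below M) ≤ (c.op ^ m) (below M) := by
    induction m with
    | zero => simp
    | succ m ih =>
      intro x
      rw [pow_succ', Module.End.mul_apply, pow_succ', Module.End.mul_apply, killedOp_apply]
      split_ifs
      · exact c.isSubMarkov_op.mono ih x
      · exact c.isSubMarkov_op.1 _ (c.isSubMarkov_op.pow_nonneg (below_nonneg M) m) x
  exact h m 0

/-- The total variation distance from the left boundary state is attained on an interval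
`{0, ..., k-1}`. -/
theorem dTVC_le {t B : ℝ} (ht : 0 ≤ t) (hB : ∀ k ≤ n + 1, c.cdf k t - c.low k ≤ B) :
    c.dTVC 0 t ≤ B := by
  set h : ℕ → ℝ := fun y => poissonMix (fun m => (c.op ^ m) (Pi.single y 1) 0) t with hh
  set g : ℕ → ℝ := fun y => poissonMix (fun m => (lazyOp c.op ^ m) (Pi.single 0 1) y) (2 * t)
    with hg
  have hgh : ∀ y ≤ n, c.weight 0 * h y = c.weight y * g y := by
    intro y hy
    simp only [hh, hg]
    rw [c.op_eq_lazy (abs_single_le y), ← poissonMix.const_mul, ← poissonMix.const_mul]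
    congr 1
    ext m
    exact c.lazy_pow_single_symm m (Nat.zero_le n) hy
  have hga : ∀ x < n, g (x + 1) ≤ g x := by
    intro x hx
    refine poissonMix.mono (C := 1) (D := 1)
      (fun m => c.isSubMarkov_op.lazy.abs_pow_le (abs_single_le 0) m _)
      (fun m => c.isSubMarkov_op.lazy.abs_pow_le (abs_single_le 0) m _)
      (fun m => c.lazy_pow_antitone (fun x _ => ?_) m x hx) (by linarith)
    rw [Pi.single_eq_of_ne (by omega)]
    exact (Pi.single_nonneg.2 (zero_le_one (α := ℝ)) : (0 : ℕ → ℝ) ≤ Pi.single 0 1) x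
  have w0 := c.weight_pos (Nat.zero_le n)
  have hd : ∀ y ≤ n, h y - c.weight y = c.weight y / c.weight 0 * (g y - c.weight 0) := by
    intro y hy
    have := hgh y hy
    field_simp
    linear_combination this
  have hr : ∀ y ≤ n, 0 ≤ c.weight y / c.weight 0 := fun y _ =>
    div_nonneg (c.weight_nonneg y) w0.le
  refine ciSup_le fun A => ?_
  obtain ⟨k, hk, hpos, hneg⟩ : ∃ k ≤ n + 1, (∀ y < k, 0 ≤ g y - c.weight 0) ∧
      ∀ y, k ≤ y → y ≤ n → g y - c.weight 0 ≤ 0 := by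
    by_cases hex : ∃ k, k ≤ n ∧ g k < c.weight 0
    · classical
      have hs := Nat.find_spec hex
      refine ⟨Nat.find hex, by omega, fun y hy => ?_, fun y hy hyn => ?_⟩
      · have := Nat.find_min hex hy
        by_contra hcon
        exact this ⟨by omega, by linarith⟩
      · linarith [le_of_antitone hga hy hyn]
    · push Not at hex
      exact ⟨n + 1, le_rfl, fun y hy => sub_nonneg.2 (hex y (by omega)), fun y _ _ => by omega⟩
  refine le_trans ?_ (hB k hk)
  rw [cdf_eq_sum, low, ← Finset.sum_sub_distrib, ← Finset.sum_sub_distrib]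
  set φ : ℕ → ℝ := fun y => h y - c.weight y with hφ
  have e1 : ∑ y ∈ A, (c.Ht t 0 y - c.pi y) = ∑ y ∈ A.map Fin.valEmbedding, φ y := by
    rw [Finset.sum_map]
    refine Finset.sum_congr rfl fun y _ => ?_
    rw [Ht_eq, ← weight_fin]
    rfl
  rw [e1]
  change _ ≤ ∑ y ∈ Finset.range k, φ y
  have hA : ∀ y ∈ A.map Fin.valEmbedding, y ≤ n := by
    intro y hy
    obtain ⟨z, _, rfl⟩ := Finset.mem_map.1 hy
    exact Nat.lt_succ_iff.1 z.2
  calc _ ≤ ∑ y ∈ A.map Fin.valEmbedding, if y < k then φ y else 0 := by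
        refine Finset.sum_le_sum fun y hy => ?_
        split_ifs with hyk
        · exact le_rfl
        · simp only [hφ]
          rw [hd y (hA y hy)]
          exact mul_nonpos_of_nonneg_of_nonpos (hr y (hA y hy)) (hneg y (by omega) (hA y hy))
    _ = ∑ y ∈ (A.map Fin.valEmbedding).filter (· < k), φ y := (Finset.sum_filter _ _).symm
    _ ≤ _ := by
        refine Finset.sum_le_sum_of_subset_of_nonneg (fun y hy => ?_) fun y hy _ => ?_
        · exact Finset.mem_range.2 (Finset.mem_filter.1 hy).2
        · have hyk := Finset.mem_range.1 hy
          simp only [hφ]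
          rw [hd y (by omega)]
          exact mul_nonneg (hr y (by omega)) (hpos y hyk)

theorem surv_sub_le_dTVC {M : ℕ} (hM : M ≤ n) {t : ℝ} (ht : 0 ≤ t) :
    c.surv M t - c.low M ≤ c.dTVC 0 t := by
  refine le_trans (sub_le_sub_right (c.surv_le_cdf M ht) _) ?_
  refine le_trans (Eq.le ?_) (le_ciSup (Set.finite_range _).bddAbove (Finset.Iio ⟨M, by omega⟩))
  rw [cdf_eq_sum, low]
  have hs : Finset.range M = (Finset.Iio (⟨M, by omega⟩ : Fin (n + 1))).map Fin.valEmbedding := by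
    ext y
    simp only [Finset.mem_range, Finset.mem_map, Finset.mem_Iio, Fin.valEmbedding_apply]
    exact ⟨fun h => ⟨⟨y, by omega⟩, h, rfl⟩, fun ⟨z, hz, hzy⟩ => hzy ▸ hz⟩
  rw [hs, Finset.sum_map, Finset.sum_map]
  congr 1
  · exact Finset.sum_congr rfl fun y _ => (c.Ht_eq t 0 y).symm
  · exact Finset.sum_congr rfl fun y _ => c.weight_fin y

theorem dTVC_le_surv {Q : ℕ} (hQ : Q ≤ n) {t : ℝ} (ht : 0 ≤ t) :
    c.dTVC 0 t ≤ c.surv Q t + (1 - c.low (Q + 1)) := by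
  refine c.dTVC_le ht fun k hk => ?_
  have h1 := c.cdf_le hk hQ ht
  have h2 := c.cdf_le_one k ht
  have h3 := c.surv_nonneg Q ht
  have h4 := c.low_pos Q
  have h5 := c.low_le_one (Q + 1)
  rcases le_total (c.low k) (c.low (Q + 1)) with h | h
  · have : c.low k / c.low (Q + 1) - c.low k ≤ 1 - c.low (Q + 1) := by
      rw [div_sub' h4.ne', div_le_iff₀ h4]
      nlinarith
    linarith
  · linarith

/-- If the chain is far from equilibrium, then it has not reached `Q` yet. -/
theorem surv_ge_of_lt_dTVC {Q : ℕ} (hQ : Q ≤ n) {t η : ℝ} (ht : 0 ≤ t)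
    (h : 1 - η < c.dTVC 0 t) : 1 - η - η / c.low (Q + 1) ≤ c.surv Q t := by
  by_contra hcon
  push Not at hcon
  refine absurd (c.dTVC_le ht fun k hk => ?_) (not_le.2 h)
  have h1 := c.cdf_le hk hQ ht
  have h2 := c.cdf_le_one k ht
  rcases le_total (c.low k) η with h3 | h3
  · have := div_le_div_of_nonneg_right h3 (c.low_pos Q).le
    linarith [c.low_nonneg k]
  · linarith

end BDChain

namespace BDChain

variable {n : ℕ} (c : BDChain n)

/-- The effective resistance between `k` and `M`. -/
def res (M k : ℕ) : ℝ := ∑ y ∈ Finset.Ico k M, (c.weight y * c.up y)⁻¹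

/-- The Green operator of the chain killed at `M`. -/
def green (M : ℕ) (f : ℕ → ℝ) (x : ℕ) : ℝ :=
  ∑ y ∈ Finset.range M, c.weight y * c.res M (max x y) * f y

/-- The expected hitting time of `M` from `0`. -/
def mean (M : ℕ) : ℝ := c.green M 1 0

/-- The variance of the hitting time of `M` from `0`, in continuous time. -/
def var (M : ℕ) : ℝ := 2 * c.green M (c.green M 1) 0 - c.mean M ^ 2

theorem res_nonneg (M k : ℕ) : 0 ≤ c.res M k :=
  Finset.sum_nonneg fun y _ => inv_nonneg.2 (mul_nonneg (c.weight_nonneg y) (c.up_nonneg y))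

theorem res_of_le {M k : ℕ} (h : M ≤ k) : c.res M k = 0 := by
  rw [res, Finset.Ico_eq_empty (by omega), Finset.sum_empty]

theorem res_of_lt {M k : ℕ} (h : k < M) :
    c.res M k = (c.weight k * c.up k)⁻¹ + c.res M (k + 1) :=
  Finset.sum_eq_sum_Ico_succ_bot h _

theorem res_antitone (M : ℕ) {k l : ℕ} (h : k ≤ l) : c.res M l ≤ c.res M k :=
  Finset.sum_le_sum_of_subset_of_nonneg (Finset.Ico_subset_Ico_left h) fun y _ _ =>
    inv_nonneg.2 (mul_nonneg (c.weight_nonneg y) (c.up_nonneg y))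

theorem res_add {k M M' : ℕ} (h : k ≤ M) (h' : M ≤ M') : c.res M k + c.res M' M = c.res M' k :=
  Finset.sum_Ico_consecutive _ h h'

theorem res_max_sub {M x y : ℕ} (hx : x < M) :
    c.res M (max x y) - c.res M (max (x + 1) y)
      = if y ≤ x then (c.weight x * c.up x)⁻¹ else 0 := by
  split_ifs with h
  · rw [max_eq_left h, max_eq_left (by omega), c.res_of_lt hx]
    ring
  · rw [max_eq_right (by omega), max_eq_right (by omega), sub_self]

theorem op_res {M x y : ℕ} (hM : M ≤ n) (hx : x < M) :
    c.op (fun z => c.res M (max z y)) x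
      = c.res M (max x y) - if x = y then (c.weight x)⁻¹ else 0 := by
  have h1 := c.rates_sum (x := x) (by omega)
  have h2 := c.res_max_sub (y := y) hx
  have hw := c.weight_pos (x := x) (by omega)
  have hu := c.up_pos (x := x) (by omega)
  rw [op_apply]
  rcases Nat.eq_zero_or_pos x with rfl | h0
  · have h3 : c.stay 0 = 1 - c.up 0 := by rw [c.down_zero] at h1; linarith
    have h4 : c.res M (max (0 + 1) y) = c.res M (max 0 y)
        - if y ≤ 0 then (c.weight 0 * c.up 0)⁻¹ else 0 := by linarith
    rw [h4, h3, c.down_zero]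
    split_ifs with h5 h6 h6 <;> first | omega | skip
    · field_simp
      ring
    · ring
  · obtain ⟨k, rfl⟩ : ∃ k, x = k + 1 := ⟨x - 1, by omega⟩
    have h3 := c.res_max_sub (M := M) (x := k) (y := y) (by omega)
    have hb := c.detailed_balance (x := k) (by omega)
    have hd := c.down_pos (x := k) (by omega)
    rw [hb] at h3
    rw [Nat.add_sub_cancel]
    have h4 : c.stay (k + 1) = 1 - c.down (k + 1) - c.up (k + 1) := by linarith
    have h5 := sub_eq_iff_eq_add.1 h3
    have h6 : c.res M (max (k + 1 + 1) y) = c.res M (max (k + 1) y)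
        - if y ≤ k + 1 then (c.weight (k + 1) * c.up (k + 1))⁻¹ else 0 := by linarith
    rw [h6, h5, h4]
    split_ifs <;> first | omega | skip
    all_goals first | (field_simp; done) | (field_simp; ring)

theorem green_of_le {M x : ℕ} (f : ℕ → ℝ) (hx : M ≤ x) : c.green M f x = 0 :=
  Finset.sum_eq_zero fun y _ => by rw [c.res_of_le (hx.trans (le_max_left _ _))]; ring

theorem green_mono (M : ℕ) {f g : ℕ → ℝ} (h : f ≤ g) : c.green M f ≤ c.green M g := fun _ =>
  Finset.sum_le_sum fun y _ => mul_le_mul_of_nonneg_left (h y)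
    (mul_nonneg (c.weight_nonneg y) (c.res_nonneg _ _))

theorem green_smul (M : ℕ) (a : ℝ) (f : ℕ → ℝ) : c.green M (a • f) = a • c.green M f := by
  ext x
  simp only [green, Pi.smul_apply, smul_eq_mul, Finset.mul_sum]
  exact Finset.sum_congr rfl fun y _ => by ring

theorem green_nonneg (M : ℕ) {f : ℕ → ℝ} (h : 0 ≤ f) : 0 ≤ c.green M f := fun _ =>
  Finset.sum_nonneg fun y _ =>
    mul_nonneg (mul_nonneg (c.weight_nonneg y) (c.res_nonneg _ _)) (h y)

theorem op_green {M x : ℕ} (hM : M ≤ n) (hx : x < M) (f : ℕ → ℝ) :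
    c.op (c.green M f) x = c.green M f x - f x := by
  have h : c.green M f
      = ∑ y ∈ Finset.range M, (c.weight y * f y) • fun z => c.res M (max z y) := by
    ext z
    rw [Finset.sum_apply]
    exact Finset.sum_congr rfl fun y _ => by simp only [Pi.smul_apply, smul_eq_mul]; ring
  rw [h, map_sum, Finset.sum_apply, Finset.sum_apply, eq_sub_iff_add_eq,
    ← Finset.sum_erase_add _ _ (Finset.mem_range.2 hx),
    ← Finset.sum_erase_add (a := x) _ _ (Finset.mem_range.2 hx), add_assoc]
  congr 1
  · refine Finset.sum_congr rfl fun y hy => ?_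
    rw [map_smul, Pi.smul_apply, Pi.smul_apply, c.op_res hM hx,
      if_neg (Finset.ne_of_mem_erase hy).symm, sub_zero]
  · have hw := c.weight_pos (x := x) (by omega)
    rw [map_smul, Pi.smul_apply, Pi.smul_apply, c.op_res hM hx, if_pos rfl, smul_eq_mul,
      smul_eq_mul]
    field_simp
    ring

theorem killedOp_green {M : ℕ} (hM : M ≤ n) {f : ℕ → ℝ} {g : ℕ → ℝ} (hf : ∀ x < M, f x = g x)
    (hg : ∀ x, M ≤ x → g x = 0) : c.killedOp M (c.green M f) = c.green M f - g := by
  ext x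
  rw [killedOp_apply, Pi.sub_apply]
  split_ifs with hx
  · rw [c.op_green hM hx, hf x hx]
  · rw [c.green_of_le f (by omega), hg x (by omega), sub_zero]

theorem green_one_le_mean (M x : ℕ) : c.green M 1 x ≤ c.mean M := by
  refine Finset.sum_le_sum fun y _ => ?_
  refine mul_le_mul_of_nonneg_right ?_ zero_le_one
  exact mul_le_mul_of_nonneg_left (c.res_antitone M (max_le_max_right y (Nat.zero_le x)))
    (c.weight_nonneg y)

theorem one_le_green {M x : ℕ} (hM : M ≤ n) (hx : x < M) : 1 ≤ c.green M 1 x := by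
  have h := c.op_green hM hx 1
  have h1 := c.isSubMarkov_op.1 _ (c.green_nonneg M zero_le_one) x
  simp only [Pi.zero_apply, Pi.one_apply] at h1 h
  linarith

theorem one_le_mean {M : ℕ} (hM : M ≤ n) (h0 : 0 < M) : 1 ≤ c.mean M := c.one_le_green hM h0

theorem green_green_le (M : ℕ) : c.green M (c.green M 1) ≤ c.mean M • c.green M 1 := by
  rw [← c.green_smul]
  exact c.green_mono M fun x => by simpa using c.green_one_le_mean M x

theorem killedOp_pow_green_le {M : ℕ} (hM : M ≤ n) (h0 : 0 < M) (m : ℕ) :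
    (c.killedOp M ^ m) (c.green M 1) ≤ (1 - (c.mean M)⁻¹) ^ m • c.green M 1 := by
  have hu := c.one_le_mean hM h0
  have hγ : 0 ≤ 1 - (c.mean M)⁻¹ := by linarith [inv_le_one_of_one_le₀ hu]
  induction m with
  | zero => simp
  | succ m ih =>
    rw [pow_succ', Module.End.mul_apply]
    refine ((c.isSubMarkov_killedOp M).mono ih).trans ?_
    rw [map_smul, pow_succ, mul_smul]
    refine smul_le_smul_of_nonneg_left ?_ (pow_nonneg hγ m)
    rw [c.killedOp_green hM (g := below M) (fun x hx => by simp [below_of_lt hx])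
      fun x hx => below_of_le hx]
    intro x
    simp only [Pi.sub_apply, Pi.smul_apply, smul_eq_mul, sub_mul, one_mul]
    rcases Nat.lt_or_ge x M with hx | hx
    · have h1 : (c.mean M)⁻¹ * c.green M 1 x ≤ (c.mean M)⁻¹ * c.mean M :=
        mul_le_mul_of_nonneg_left (c.green_one_le_mean M x) (by positivity)
      rw [inv_mul_cancel₀ (by positivity)] at h1
      rw [below_of_lt hx]
      linarith
    · simp [c.green_of_le 1 hx, below_of_le hx]

/-- `E_0 (τ̃_M - t)^+`. -/
def tail (M : ℕ) (t : ℝ) : ℝ := poissonMix (fun m => (c.killedOp M ^ m) (c.green M 1) 0) t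

/-- Half of `E_0 ((τ̃_M - t)^+)^2`. -/
def tail₂ (M : ℕ) (t : ℝ) : ℝ :=
  poissonMix (fun m => (c.killedOp M ^ m) (c.green M (c.green M 1)) 0) t

theorem mean_nonneg (M : ℕ) : 0 ≤ c.mean M := c.green_nonneg M zero_le_one 0

theorem abs_green_le (M x : ℕ) : |c.green M 1 x| ≤ c.mean M := by
  rw [abs_of_nonneg (c.green_nonneg M zero_le_one x)]
  exact c.green_one_le_mean M x

theorem abs_green_green_le (M x : ℕ) : |c.green M (c.green M 1) x| ≤ c.mean M * c.mean M := by
  rw [abs_of_nonneg (c.green_nonneg M (c.green_nonneg M zero_le_one) x)]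
  exact (c.green_green_le M x).trans
    (mul_le_mul_of_nonneg_left (c.green_one_le_mean M x) (c.mean_nonneg M))

theorem abs_pow_green_le (M m : ℕ) : |(c.killedOp M ^ m) (c.green M 1) 0| ≤ c.mean M :=
  (c.isSubMarkov_killedOp M).abs_pow_le (c.abs_green_le M) m 0

theorem abs_pow_green_green_le (M m : ℕ) :
    |(c.killedOp M ^ m) (c.green M (c.green M 1)) 0| ≤ c.mean M * c.mean M :=
  (c.isSubMarkov_killedOp M).abs_pow_le (c.abs_green_green_le M) m 0

theorem tail_zero (M : ℕ) : c.tail M 0 = c.mean M := by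
  rw [tail, poissonMix.zero_right, pow_zero, Module.End.one_apply, mean]

theorem tail₂_zero (M : ℕ) : c.tail₂ M 0 = c.green M (c.green M 1) 0 := by
  rw [tail₂, poissonMix.zero_right, pow_zero, Module.End.one_apply]

theorem tail_nonneg (M : ℕ) {t : ℝ} (ht : 0 ≤ t) : 0 ≤ c.tail M t :=
  poissonMix.nonneg (fun m => (c.isSubMarkov_killedOp M).pow_nonneg
    (c.green_nonneg M zero_le_one) m 0) ht

theorem tail₂_nonneg (M : ℕ) {t : ℝ} (ht : 0 ≤ t) : 0 ≤ c.tail₂ M t :=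
  poissonMix.nonneg (fun m => (c.isSubMarkov_killedOp M).pow_nonneg
    (c.green_nonneg M (c.green_nonneg M zero_le_one)) m 0) ht

theorem tail_le {M : ℕ} (hM : M ≤ n) (h0 : 0 < M) {t : ℝ} (ht : 0 ≤ t) :
    c.tail M t ≤ c.mean M * Real.exp (-((c.mean M)⁻¹ * t)) := by
  have hu := c.one_le_mean hM h0
  have hγ : 0 ≤ 1 - (c.mean M)⁻¹ := by linarith [inv_le_one_of_one_le₀ hu]
  have hγ' : 1 - (c.mean M)⁻¹ ≤ 1 := by
    have : 0 ≤ (c.mean M)⁻¹ := by positivity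
    linarith
  have h := poissonMix.geometric (1 - (c.mean M)⁻¹) t
  rw [sub_sub_cancel] at h
  rw [← h, ← poissonMix.const_mul]
  refine poissonMix.mono (c.abs_pow_green_le M) (D := c.mean M) (fun m => ?_) (fun m => ?_) ht
  · rw [abs_of_nonneg (by positivity)]
    exact mul_le_of_le_one_right (c.mean_nonneg M) (pow_le_one₀ hγ hγ')
  · have := c.killedOp_pow_green_le hM h0 m 0
    rw [mul_comm]
    exact this

theorem tail₂_le (M : ℕ) {t : ℝ} (ht : 0 ≤ t) : c.tail₂ M t ≤ c.mean M * c.tail M t := by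
  rw [tail, ← poissonMix.const_mul]
  refine poissonMix.mono (c.abs_pow_green_green_le M) (D := c.mean M * c.mean M) (fun m => ?_)
    (fun m => ?_) ht
  · rw [abs_mul, abs_of_nonneg (c.mean_nonneg M)]
    exact mul_le_mul_of_nonneg_left (c.abs_pow_green_le M m) (c.mean_nonneg M)
  · have := (c.isSubMarkov_killedOp M).pow_mono (c.green_green_le M) m 0
    rwa [map_smul] at this

theorem hasDerivAt_tail {M : ℕ} (hM : M ≤ n) (t : ℝ) :
    HasDerivAt (c.tail M) (-c.surv M t) t := by
  refine (poissonMix.hasDerivAt (c.abs_pow_green_le M) t).congr_deriv ?_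
  rw [surv, ← neg_one_mul, ← poissonMix.const_mul]
  congr 1
  ext m
  rw [pow_succ, Module.End.mul_apply, c.killedOp_green hM (g := below M)
    (fun x hx => by simp [below_of_lt hx]) (fun x hx => below_of_le hx), map_sub, Pi.sub_apply]
  ring

theorem hasDerivAt_tail₂ {M : ℕ} (hM : M ≤ n) (t : ℝ) :
    HasDerivAt (c.tail₂ M) (-c.tail M t) t := by
  refine (poissonMix.hasDerivAt (c.abs_pow_green_green_le M) t).congr_deriv ?_
  rw [tail, ← neg_one_mul, ← poissonMix.const_mul]
  congr 1
  ext m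
  rw [pow_succ, Module.End.mul_apply, c.killedOp_green hM (g := c.green M 1) (fun _ _ => rfl)
    (fun _ hx => c.green_of_le 1 hx), map_sub, Pi.sub_apply]
  ring

theorem tendsto_tail {M : ℕ} (hM : M ≤ n) (h0 : 0 < M) :
    Tendsto (c.tail M) atTop (nhds 0) := by
  have hu : 0 < c.mean M := zero_lt_one.trans_le (c.one_le_mean hM h0)
  have h : Tendsto (fun t : ℝ => c.mean M * Real.exp (-((c.mean M)⁻¹ * t))) atTop (nhds 0) := by
    rw [← mul_zero (c.mean M)]
    exact (Real.tendsto_exp_neg_atTop_nhds_zero.comp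
      (tendsto_id.const_mul_atTop (inv_pos.2 hu))).const_mul _
  refine tendsto_of_tendsto_of_tendsto_of_le_of_le' tendsto_const_nhds h ?_ ?_
  · filter_upwards [eventually_ge_atTop 0] with t ht using c.tail_nonneg M ht
  · filter_upwards [eventually_ge_atTop 0] with t ht using c.tail_le hM h0 ht

theorem tendsto_mul_tail {M : ℕ} (hM : M ≤ n) (h0 : 0 < M) :
    Tendsto (fun t => t * c.tail M t) atTop (nhds 0) := by
  have hu : 0 < c.mean M := zero_lt_one.trans_le (c.one_le_mean hM h0)
  have h : Tendsto (fun t : ℝ => c.mean M * c.mean M * (((c.mean M)⁻¹ * t) ^ 1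
      * Real.exp (-((c.mean M)⁻¹ * t)))) atTop (nhds 0) := by
    rw [← mul_zero (c.mean M * c.mean M)]
    exact ((Real.tendsto_pow_mul_exp_neg_atTop_nhds_zero 1).comp
      (tendsto_id.const_mul_atTop (inv_pos.2 hu))).const_mul _
  refine tendsto_of_tendsto_of_tendsto_of_le_of_le' tendsto_const_nhds h ?_ ?_
  · filter_upwards [eventually_ge_atTop 0] with t ht using mul_nonneg ht (c.tail_nonneg M ht)
  · filter_upwards [eventually_ge_atTop 0] with t ht
    refine (mul_le_mul_of_nonneg_left (c.tail_le hM h0 ht) ht).trans_eq ?_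
    field_simp

theorem tendsto_tail₂ {M : ℕ} (hM : M ≤ n) (h0 : 0 < M) :
    Tendsto (c.tail₂ M) atTop (nhds 0) := by
  have h := (c.tendsto_tail hM h0).const_mul (c.mean M)
  rw [mul_zero] at h
  refine tendsto_of_tendsto_of_tendsto_of_le_of_le' tendsto_const_nhds h ?_ ?_
  · filter_upwards [eventually_ge_atTop 0] with t ht using c.tail₂_nonneg M ht
  · filter_upwards [eventually_ge_atTop 0] with t ht using c.tail₂_le M ht

theorem integral_surv {M : ℕ} (hM : M ≤ n) (h0 : 0 < M) :
    ∫ t in Set.Ioi (0 : ℝ), c.surv M t = c.mean M := by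
  have h := integral_Ioi_of_hasDerivAt_of_nonneg' (a := 0) (g := fun t => -c.tail M t)
    (g' := c.surv M) (l := -0)
    (fun t _ => (c.hasDerivAt_tail hM t).neg.congr_deriv (neg_neg _))
    (fun t ht => c.surv_nonneg M (le_of_lt ht)) (c.tendsto_tail hM h0).neg
  rw [h, tail_zero]
  ring

theorem integral_mul_surv {M : ℕ} (hM : M ≤ n) (h0 : 0 < M) :
    ∫ t in Set.Ioi (0 : ℝ), 2 * t * c.surv M t = 2 * c.green M (c.green M 1) 0 := by
  have h := integral_Ioi_of_hasDerivAt_of_nonneg' (a := 0)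
    (g := fun t => -2 * (t * c.tail M t) + -2 * c.tail₂ M t)
    (g' := fun t => 2 * t * c.surv M t) (l := -2 * 0 + -2 * 0)
    (fun t _ => ((((hasDerivAt_id t).mul (c.hasDerivAt_tail hM t)).const_mul (-2)).add
        ((c.hasDerivAt_tail₂ hM t).const_mul (-2))).congr_deriv (by simp only [id]; ring))
    (fun t ht => mul_nonneg (mul_nonneg zero_le_two (le_of_lt ht)) (c.surv_nonneg M (le_of_lt ht)))
    (((c.tendsto_mul_tail hM h0).const_mul _).add ((c.tendsto_tail₂ hM h0).const_mul _))
  rw [h, tail₂_zero]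
  ring

theorem hitMeanC_eq (M : Fin (n + 1)) (h0 : 0 < (M : ℕ)) : c.hitMeanC M 0 = c.mean M := by
  rw [hitMeanC, ← c.integral_surv (Nat.lt_succ_iff.1 M.2) h0]
  simp only [hitSurvC_eq]

theorem hitVarC_eq (M : Fin (n + 1)) (h0 : 0 < (M : ℕ)) : c.hitVarC M 0 = c.var M := by
  rw [hitVarC, c.hitMeanC_eq M h0, var, ← c.integral_mul_surv (Nat.lt_succ_iff.1 M.2) h0]
  simp only [hitSurvC_eq]

theorem surv_mono {M M' : ℕ} (h : M ≤ M') {t : ℝ} (ht : 0 ≤ t) : c.surv M t ≤ c.surv M' t := by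
  refine poissonMix.mono (c.abs_killedOp_pow_le M · 0) (c.abs_killedOp_pow_le M' · 0)
    (fun m => ?_) ht
  have h (m : ℕ) : (c.killedOp M ^ m) (below M) ≤ (c.killedOp M' ^ m) (below M') := by
    induction m with
    | zero =>
      intro x
      simp only [pow_zero, Module.End.one_apply, below]
      split_ifs <;> first | simp | omega
    | succ m ih =>
      intro x
      rw [pow_succ', Module.End.mul_apply, pow_succ', Module.End.mul_apply, killedOp_apply,
        killedOp_apply]
      split_ifs
      · exact c.isSubMarkov_op.mono ih x
      · omega
      · exact c.isSubMarkov_op.1 _ ((c.isSubMarkov_killedOp M').pow_nonneg (below_nonneg M') m) x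
      · exact le_rfl
  exact h m 0

theorem tail_mono {M M' : ℕ} (h : M ≤ M') {t : ℝ} (ht : 0 ≤ t) : c.tail M t ≤ c.tail M' t := by
  refine poissonMix.mono (c.abs_pow_green_le M) (c.abs_pow_green_le M') (fun m => ?_) ht
  have hg : ∀ M, 0 ≤ c.green M 1 := fun M => c.green_nonneg M zero_le_one
  have h (m : ℕ) : (c.killedOp M ^ m) (c.green M 1) ≤ (c.killedOp M' ^ m) (c.green M' 1) := by
    induction m with
    | zero =>
      intro x
      simp only [pow_zero, Module.End.one_apply]
      rcases Nat.lt_or_ge x M with hx | hx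
      · refine (Finset.sum_le_sum fun y hy => ?_).trans
          (Finset.sum_le_sum_of_subset_of_nonneg (Finset.range_mono h) fun y _ _ =>
            mul_nonneg (mul_nonneg (c.weight_nonneg y) (c.res_nonneg _ _)) zero_le_one)
        refine mul_le_mul_of_nonneg_right (mul_le_mul_of_nonneg_left ?_ (c.weight_nonneg y))
          zero_le_one
        rw [← c.res_add (max_le hx.le (Finset.mem_range.1 hy).le) h]
        exact le_add_of_nonneg_right (c.res_nonneg _ _)
      · rw [c.green_of_le 1 hx]
        exact hg M' x
    | succ m ih =>
      intro x
      rw [pow_succ', Module.End.mul_apply, pow_succ', Module.End.mul_apply, killedOp_apply,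
        killedOp_apply]
      split_ifs
      · exact c.isSubMarkov_op.mono ih x
      · omega
      · exact c.isSubMarkov_op.1 _ ((c.isSubMarkov_killedOp M').pow_nonneg (hg M') m) x
      · exact le_rfl
  exact h m 0

/-- Comparison of increments from comparison of derivatives. -/
theorem _root_.sub_le_sub_of_hasDerivAt_le {f g f' g' : ℝ → ℝ} {a b : ℝ} (hab : a ≤ b)
    (hf : ∀ t, HasDerivAt f (f' t) t) (hg : ∀ t, HasDerivAt g (g' t) t)
    (h : ∀ t, a ≤ t → t ≤ b → f' t ≤ g' t) : f b - f a ≤ g b - g a := by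
  have hd (t : ℝ) : HasDerivAt (fun t => g t - f t) (g' t - f' t) t := (hg t).sub (hf t)
  have hm : MonotoneOn (fun t => g t - f t) (Set.Icc a b) := by
    refine monotoneOn_of_deriv_nonneg (convex_Icc a b)
      (fun t _ => (hd t).continuousAt.continuousWithinAt)
      (fun t _ => (hd t).differentiableAt.differentiableWithinAt) fun t ht => ?_
    rw [interior_Icc] at ht
    rw [(hd t).deriv]
    linarith [h t ht.1.le ht.2.le]
  have := hm (Set.left_mem_Icc.2 hab) (Set.right_mem_Icc.2 hab) hab
  simp only at this
  linarith

theorem surv_antitone (M : ℕ) {s t : ℝ} (hs : 0 ≤ s) (hst : s ≤ t) :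
    c.surv M t ≤ c.surv M s := by
  have h := sub_le_sub_of_hasDerivAt_le hst (f := c.surv M) (g := fun _ => 0)
    (fun t => poissonMix.hasDerivAt (c.abs_killedOp_pow_le M · 0) t)
    (fun t => hasDerivAt_const t 0) fun t ht _ => by
      refine (poissonMix.mono (C := 2) (D := 0) (b := fun _ => 0) (fun m => ?_) (by simp)
        (fun m => ?_) (hs.trans ht)).trans_eq (poissonMix.const 0 t)
      · refine (abs_sub _ _).trans ?_
        linarith [c.abs_killedOp_pow_le M m 0, c.abs_killedOp_pow_le M (m + 1) 0]
      · rw [sub_nonpos, pow_succ, Module.End.mul_apply]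
        refine (c.isSubMarkov_killedOp M).pow_mono (fun x => ?_) m 0
        rw [killedOp_apply, below]
        split_ifs
        · refine (c.isSubMarkov_op.mono (below_le_one M) x).trans (c.isSubMarkov_op.2 x)
        · exact le_rfl
  linarith

theorem mul_surv_le_mean {M : ℕ} (hM : M ≤ n) {s : ℝ} (hs : 0 ≤ s) :
    s * c.surv M s ≤ c.mean M := by
  have h := sub_le_sub_of_hasDerivAt_le hs (f := c.tail M) (g := fun t => -(t * c.surv M s))
    (c.hasDerivAt_tail hM) (fun t => ((hasDerivAt_id t).mul_const _).neg) fun t ht hts => by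
      rw [one_mul]
      exact neg_le_neg (c.surv_antitone M ht hts)
  rw [tail_zero] at h
  linarith [c.tail_nonneg M hs]

theorem surv_sub_le {M M' : ℕ} (h : M ≤ M') (hM : M' ≤ n) {s r : ℝ} (hs : 0 ≤ s) (hr : 0 ≤ r) :
    r * (c.surv M' (s + r) - c.surv M s) ≤ c.mean M' - c.mean M := by
  have hd (t : ℝ) : HasDerivAt (fun t => c.tail M' t - c.tail M t)
      (-c.surv M' t - -c.surv M t) t :=
    (c.hasDerivAt_tail hM t).sub (c.hasDerivAt_tail (h.trans hM) t)
  have h1 := sub_le_sub_of_hasDerivAt_le hs hd (fun t => hasDerivAt_const t (0 : ℝ))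
    fun t ht _ => by linarith [c.surv_mono h ht]
  have h2 := sub_le_sub_of_hasDerivAt_le (le_add_of_nonneg_right hr : s ≤ s + r) hd
    (fun t => ((hasDerivAt_id t).mul_const (c.surv M' (s + r) - c.surv M s)).neg)
    fun t ht hts => by
      rw [one_mul]
      linarith [c.surv_antitone M' (hs.trans ht) hts, c.surv_antitone M hs ht]
  simp only [tail_zero, id, Pi.neg_apply] at h1 h2
  linarith [c.tail_mono h (add_nonneg hs hr)]

theorem hasDerivAt_tail_center {M : ℕ} (hM : M ≤ n) (a t : ℝ) :
    HasDerivAt (fun t => -2 * ((t - a) * c.tail M t) + -2 * c.tail₂ M t)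
      (2 * (t - a) * c.surv M t) t := by
  refine (((((hasDerivAt_id t).sub_const a).mul (c.hasDerivAt_tail hM t)).const_mul (-2)).add
    ((c.hasDerivAt_tail₂ hM t).const_mul (-2))).congr_deriv ?_
  simp only [id]
  ring

theorem hasDerivAt_sq_center (a t : ℝ) :
    HasDerivAt (fun t : ℝ => (t - a) ^ 2) (2 * (t - a)) t := by
  refine (((hasDerivAt_id t).sub_const a).pow 2).congr_deriv ?_
  simp

theorem tail_center_ge {M : ℕ} (hM : M ≤ n) {t : ℝ} (ht : 0 ≤ t) (htu : t ≤ c.mean M) :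
    (t - c.mean M) ^ 2 - c.var M
      ≤ -2 * ((t - c.mean M) * c.tail M t) + -2 * c.tail₂ M t := by
  have h := sub_le_sub_of_hasDerivAt_le ht (hasDerivAt_sq_center (c.mean M))
    (c.hasDerivAt_tail_center hM (c.mean M)) fun t ht ht' => by
      nlinarith [c.surv_le_one M ht]
  rw [tail_zero, tail₂_zero] at h
  rw [var]
  linarith

theorem chebyshev_lower {M : ℕ} (hM : M ≤ n) {r : ℝ} (hr : 0 ≤ r) (hr' : r ≤ c.mean M) :
    r ^ 2 * (1 - c.surv M (c.mean M - r)) ≤ c.var M := by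
  have h1 := c.tail_center_ge hM (t := c.mean M - r) (by linarith) (by linarith)
  have h2 := sub_le_sub_of_hasDerivAt_le (a := c.mean M - r) (b := c.mean M) (by linarith)
    (fun t => (hasDerivAt_sq_center (c.mean M) t).mul_const (c.surv M (c.mean M - r)))
    (c.hasDerivAt_tail_center hM (c.mean M)) fun t ht ht' => by
      nlinarith [c.surv_antitone M (by linarith) ht]
  have h3 := c.tail₂_nonneg M (c.mean_nonneg M)
  nlinarith

theorem chebyshev_upper {M : ℕ} (hM : M ≤ n) {r : ℝ} (hr : 0 ≤ r) :
    r ^ 2 * c.surv M (c.mean M + r) ≤ c.var M := by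
  have h1 := c.tail_center_ge hM (c.mean_nonneg M) le_rfl
  have h2 := sub_le_sub_of_hasDerivAt_le (a := c.mean M) (b := c.mean M + r) (by linarith)
    (fun t => (hasDerivAt_sq_center (c.mean M) t).mul_const (c.surv M (c.mean M + r)))
    (c.hasDerivAt_tail_center hM (c.mean M)) fun t ht ht' => by
      have := c.mean_nonneg M
      nlinarith [c.surv_antitone M (s := t) (by linarith) ht']
  have h3 := c.tail₂_nonneg M (add_nonneg (c.mean_nonneg M) hr)
  have h4 := mul_nonneg hr (c.tail_nonneg M (add_nonneg (c.mean_nonneg M) hr))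
  nlinarith

theorem mean_eq (M : ℕ) : c.mean M = ∑ y ∈ Finset.range M, c.weight y * c.res M y := by
  rw [mean, green]
  exact Finset.sum_congr rfl fun y _ => by simp

theorem var_eq (M : ℕ) :
    c.var M = ∑ x ∈ Finset.range M, ∑ y ∈ Finset.range M,
      c.weight x * c.weight y * c.res M (max x y) ^ 2 := by
  have h1 : c.green M (c.green M 1) 0 = ∑ x ∈ Finset.range M, ∑ y ∈ Finset.range M,
      c.weight x * c.weight y * (c.res M x * c.res M (max x y)) := by
    refine Finset.sum_congr rfl fun x _ => ?_
    rw [green, Finset.mul_sum]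
    refine Finset.sum_congr rfl fun y _ => ?_
    simp only [Nat.zero_max, Pi.one_apply]
    ring
  have h2 : c.green M (c.green M 1) 0 = ∑ x ∈ Finset.range M, ∑ y ∈ Finset.range M,
      c.weight x * c.weight y * (c.res M y * c.res M (max x y)) := by
    rw [h1, Finset.sum_comm]
    refine Finset.sum_congr rfl fun x _ => Finset.sum_congr rfl fun y _ => ?_
    rw [max_comm]
    ring
  have h3 : c.mean M ^ 2 = ∑ x ∈ Finset.range M, ∑ y ∈ Finset.range M,
      c.weight x * c.weight y * (c.res M x * c.res M y) := by
    rw [sq, mean_eq, Finset.sum_mul_sum]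
    exact Finset.sum_congr rfl fun x _ => Finset.sum_congr rfl fun y _ => by ring
  rw [var, two_mul, h3]
  nth_rewrite 1 [h1]
  rw [h2]
  simp only [← Finset.sum_add_distrib, ← Finset.sum_sub_distrib]
  refine Finset.sum_congr rfl fun x _ => Finset.sum_congr rfl fun y _ => ?_
  rcases le_total x y with h | h
  · rw [max_eq_right h]
    ring
  · rw [max_eq_left h]
    ring

theorem res_pos {M k : ℕ} (hM : M ≤ n) (hk : k < M) : 0 < c.res M k := by
  rw [c.res_of_lt hk]
  have h1 := c.weight_pos (x := k) (by omega)
  have h2 := c.up_pos (x := k) (by omega)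
  have h3 := c.res_nonneg M (k + 1)
  positivity

theorem low_mul_res_le {k M : ℕ} (h : k < M) :
    (c.low (k + 1) * c.res M k) ^ 2 ≤ c.var M := by
  have h1 : (c.low (k + 1) * c.res M k) ^ 2 = ∑ x ∈ Finset.range (k + 1),
      ∑ y ∈ Finset.range (k + 1), c.weight x * c.weight y * c.res M k ^ 2 := by
    rw [mul_pow, sq (c.low _), low, Finset.sum_mul_sum, Finset.sum_mul]
    exact Finset.sum_congr rfl fun x _ => Finset.sum_mul _ _ _
  rw [h1, var_eq]
  have hs : Finset.range (k + 1) ⊆ Finset.range M := Finset.range_mono h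
  have h0 (x y : ℕ) : 0 ≤ c.weight x * c.weight y :=
    mul_nonneg (c.weight_nonneg x) (c.weight_nonneg y)
  refine (Finset.sum_le_sum fun x hx => (Finset.sum_le_sum fun y hy => ?_).trans
    (Finset.sum_le_sum_of_subset_of_nonneg hs fun y _ _ => mul_nonneg (h0 x y) (sq_nonneg _))).trans
    (Finset.sum_le_sum_of_subset_of_nonneg hs fun x _ _ => Finset.sum_nonneg fun y _ =>
      mul_nonneg (h0 x y) (sq_nonneg (c.res M (max x y))))
  have hxk := Finset.mem_range.1 hx
  have hyk := Finset.mem_range.1 hy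
  exact mul_le_mul_of_nonneg_left (pow_le_pow_left₀ (c.res_nonneg _ _)
    (c.res_antitone M (max_le (by omega) (by omega))) 2) (h0 x y)

theorem var_pos {M : ℕ} (hM : M ≤ n) (h0 : 0 < M) : 0 < c.var M :=
  lt_of_lt_of_le (pow_pos (mul_pos (c.low_pos 0) (c.res_pos hM h0)) 2) (c.low_mul_res_le h0)

theorem mean_mono {M M' : ℕ} (h : M ≤ M') : c.mean M ≤ c.mean M' := by
  have := c.tail_mono h le_rfl
  rwa [tail_zero, tail_zero] at this

theorem low_mul_mean_sub_le {M M' : ℕ} (h : M ≤ M') :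
    c.low (M + 1) * (c.mean M' - c.mean M) ≤ √(c.var M') := by
  rcases h.eq_or_lt with rfl | hlt
  · simp
  have h1 : c.mean M' - c.mean M ≤ c.res M' M := by
    rw [mean_eq, mean_eq, sub_le_iff_le_add, ← Finset.sum_range_add_sum_Ico _ h]
    have e1 : ∑ y ∈ Finset.range M, c.weight y * c.res M' y
        = ∑ y ∈ Finset.range M, c.weight y * c.res M y + c.low M * c.res M' M := by
      rw [low, Finset.sum_mul, ← Finset.sum_add_distrib]
      refine Finset.sum_congr rfl fun y hy => ?_
      rw [← c.res_add (Finset.mem_range.1 hy).le h]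
      ring
    have e2 : ∑ y ∈ Finset.Ico M M', c.weight y * c.res M' y
        ≤ (c.low M' - c.low M) * c.res M' M := by
      rw [low, low, ← Finset.sum_range_add_sum_Ico _ h, add_sub_cancel_left, Finset.sum_mul]
      exact Finset.sum_le_sum fun y hy => mul_le_mul_of_nonneg_left
        (c.res_antitone M' (Finset.mem_Ico.1 hy).1) (c.weight_nonneg y)
    have e3 : c.low M' * c.res M' M ≤ 1 * c.res M' M :=
      mul_le_mul_of_nonneg_right (c.low_le_one M') (c.res_nonneg _ _)
    linarith
  refine (mul_le_mul_of_nonneg_left h1 (c.low_nonneg _)).trans ?_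
  exact Real.le_sqrt_of_sq_le (c.low_mul_res_le hlt)

end BDChain

namespace BDChain

variable {n : ℕ} (c : BDChain n)

theorem res_max_eq_sum (M x y : ℕ) :
    c.res M (max x y) = ∑ k ∈ Finset.range M,
      (c.weight k * c.up k)⁻¹ * (below (k + 1) x * below (k + 1) y) := by
  rw [res]
  refine (Finset.sum_congr rfl fun k hk => ?_).trans
    (Finset.sum_subset (s₁ := Finset.Ico (max x y) M) (fun k hk => ?_) fun k hk hk' => ?_)
  · have := (Finset.mem_Ico.1 hk).1
    rw [below_of_lt (by omega), below_of_lt (by omega)]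
    ring
  · exact Finset.mem_range.2 (Finset.mem_Ico.1 hk).2
  · rw [Finset.mem_Ico] at hk'
    rw [Finset.mem_range] at hk
    rcases Nat.lt_or_ge k x with h | h
    · rw [below_of_le (show k + 1 ≤ x by omega)]
      ring
    · rw [below_of_le (show k + 1 ≤ y by omega)]
      ring

theorem sum_mul_res_max (M : ℕ) (a : ℕ → ℕ → ℝ) :
    ∑ x ∈ Finset.range M, ∑ y ∈ Finset.range M, a x y * c.res M (max x y)
      = ∑ k ∈ Finset.range M, (c.weight k * c.up k)⁻¹ * ∑ x ∈ Finset.range M,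
        ∑ y ∈ Finset.range M, a x y * (below (k + 1) x * below (k + 1) y) := by
  simp only [res_max_eq_sum, Finset.mul_sum]
  refine Eq.trans (Finset.sum_congr rfl fun x _ => Finset.sum_comm) ?_
  rw [Finset.sum_comm]
  exact Finset.sum_congr rfl fun k _ => Finset.sum_congr rfl fun x _ =>
    Finset.sum_congr rfl fun y _ => by ring

/-- The quadratic form of the Green operator. -/
def greenForm (M : ℕ) (f : ℕ → ℝ) : ℝ :=
  ∑ x ∈ Finset.range M, ∑ y ∈ Finset.range M,
    c.weight x * c.weight y * c.res M (max x y) * (f x * f y)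

theorem greenForm_nonneg (M : ℕ) (f : ℕ → ℝ) : 0 ≤ c.greenForm M f := by
  have h : c.greenForm M f = ∑ k ∈ Finset.range M, (c.weight k * c.up k)⁻¹ *
      (∑ x ∈ Finset.range M, c.weight x * below (k + 1) x * f x) ^ 2 := by
    simp only [greenForm, mul_right_comm _ (c.res M _)]
    rw [sum_mul_res_max]
    refine Finset.sum_congr rfl fun k _ => ?_
    rw [sq, Finset.sum_mul_sum]
    congr 1
    exact Finset.sum_congr rfl fun x _ => Finset.sum_congr rfl fun y _ => by ring
  rw [h]
  exact Finset.sum_nonneg fun k _ => mul_nonneg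
    (inv_nonneg.2 (mul_nonneg (c.weight_nonneg k) (c.up_nonneg k))) (sq_nonneg _)

theorem var_eq_sum_greenForm (M : ℕ) :
    c.var M = ∑ k ∈ Finset.range M, (c.weight k * c.up k)⁻¹ * c.greenForm M (below (k + 1)) := by
  simp only [var_eq, sq (c.res M _), ← mul_assoc]
  rw [sum_mul_res_max]
  rfl

theorem mean_eq_sum (M : ℕ) :
    c.mean M = ∑ k ∈ Finset.range M, (c.weight k * c.up k)⁻¹ *
      ∑ x ∈ Finset.range M, c.weight x * below (k + 1) x ^ 2 := by
  have h (x : ℕ) : c.res M x = ∑ k ∈ Finset.range M,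
      (c.weight k * c.up k)⁻¹ * below (k + 1) x ^ 2 := by
    simpa [sq] using c.res_max_eq_sum M x x
  simp only [mean_eq, h, Finset.mul_sum]
  rw [Finset.sum_comm]
  exact Finset.sum_congr rfl fun k _ => Finset.sum_congr rfl fun x _ => by ring

theorem dot_eq_of_le {M : ℕ} (hM : M ≤ n) {f : ℕ → ℝ} (hf : ∀ x, M ≤ x → f x = 0) (g : ℕ → ℝ) :
    c.dot f g = ∑ x ∈ Finset.range M, c.weight x * (f x * g x) := by
  rw [dot, ← Finset.sum_subset (Finset.range_mono (show M ≤ n + 1 by omega))]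
  intro x _ hx
  rw [hf x (by simpa using hx)]
  ring

theorem dot_comm (f g : ℕ → ℝ) : c.dot f g = c.dot g f := by
  simp only [dot, mul_comm (f _)]

theorem dot_sub (f g h : ℕ → ℝ) : c.dot f (g - h) = c.dot f g - c.dot f h := by
  simp only [dot, Pi.sub_apply, mul_sub, Finset.sum_sub_distrib]

theorem dot_smul (f : ℕ → ℝ) (a : ℝ) (g : ℕ → ℝ) : c.dot f (a • g) = a * c.dot f g := by
  simp only [dot, Finset.mul_sum, Pi.smul_apply, smul_eq_mul]
  exact Finset.sum_congr rfl fun x _ => by ring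

theorem dot_killedOp {M : ℕ} (hM : M ≤ n) {f g : ℕ → ℝ} (hf : ∀ x, M ≤ x → f x = 0)
    (hg : ∀ x, M ≤ x → g x = 0) : c.dot f (c.killedOp M g) = c.dot (c.killedOp M f) g := by
  have h (f g : ℕ → ℝ) (hf : ∀ x, M ≤ x → f x = 0) :
      c.dot f (c.killedOp M g) = c.dot f (c.op g) := by
    rw [c.dot_eq_of_le hM hf, c.dot_eq_of_le hM hf]
    exact Finset.sum_congr rfl fun x hx => by rw [killedOp_apply, if_pos (Finset.mem_range.1 hx)]
  rw [h f g hf, dot_op, dot_comm, ← h g f hg, dot_comm]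

theorem dot_lazy_killedOp_pow {M : ℕ} (hM : M ≤ n) {f g : ℕ → ℝ} (hf : ∀ x, M ≤ x → f x = 0)
    (hg : ∀ x, M ≤ x → g x = 0) (m : ℕ) :
    c.dot f ((lazyOp (c.killedOp M) ^ m) g) = c.dot ((lazyOp (c.killedOp M) ^ m) f) g ∧
      ∀ x, M ≤ x → (lazyOp (c.killedOp M) ^ m) f x = 0 := by
  induction m generalizing f with
  | zero => simpa using hf
  | succ m ih =>
    have h1 (f : ℕ → ℝ) : lazyOp (c.killedOp M) f = (1 / 2 : ℝ) • (f + c.killedOp M f) := by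
      simp [lazyOp]
    have hs (f : ℕ → ℝ) (hf : ∀ x, M ≤ x → f x = 0) :
        ∀ x, M ≤ x → lazyOp (c.killedOp M) f x = 0 := fun x hx => by
      rw [lazyOp_apply, killedOp_apply, hf x hx, if_neg (by omega)]
      norm_num
    have hs' (m : ℕ) : ∀ x, M ≤ x → (lazyOp (c.killedOp M) ^ m) g x = 0 := by
      induction m with
      | zero => simpa using hg
      | succ m ih' =>
        rw [pow_succ', Module.End.mul_apply]
        exact hs _ ih'
    have h2 (f g : ℕ → ℝ) (hf : ∀ x, M ≤ x → f x = 0) (hg : ∀ x, M ≤ x → g x = 0) :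
        c.dot f (lazyOp (c.killedOp M) g) = c.dot (lazyOp (c.killedOp M) f) g := by
      have h3 (f g : ℕ → ℝ) : c.dot f (lazyOp (c.killedOp M) g)
          = (c.dot f g + c.dot f (c.killedOp M g)) / 2 := by
        simp only [dot, ← Finset.sum_add_distrib, Finset.sum_div]
        exact Finset.sum_congr rfl fun x _ => by rw [lazyOp_apply]; ring
      rw [h3, dot_comm _ (lazyOp _ f), h3, c.dot_killedOp hM hf hg, dot_comm _ g f,
        dot_comm _ g (c.killedOp M f)]
    have h4 := ih (hs f hf)
    rw [pow_succ', Module.End.mul_apply, h2 _ _ hf (hs' m), h4.1, ← Module.End.mul_apply,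
      ← pow_succ, pow_succ']
    refine ⟨rfl, ?_⟩
    rw [← pow_succ', pow_succ]
    exact h4.2

theorem dot_green_of_eigen {M : ℕ} (hM : M ≤ n) {l : ℝ} {g : ℕ → ℝ} (hg : ∀ x, M ≤ x → g x = 0)
    (he : ∀ x < M, c.op g x = (1 - l) * g x) {h : ℕ → ℝ} (hh : ∀ x, M ≤ x → h x = 0) :
    l * c.dot (c.green M h) g = c.dot h g := by
  have hk : c.killedOp M g = (1 - l) • g := by
    ext x
    rw [killedOp_apply, Pi.smul_apply, smul_eq_mul]
    split_ifs with hx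
    · exact he x hx
    · rw [hg x (by omega), mul_zero]
  have h1 := c.dot_killedOp hM (f := c.green M h) (fun x hx => c.green_of_le h hx) hg
  rw [c.killedOp_green hM (fun _ _ => rfl) hh, hk, dot_smul, dot_comm _ (_ - _), dot_sub,
    dot_comm _ g, dot_comm _ g] at h1
  linarith

theorem eigen_green {M : ℕ} (hM : M ≤ n) {l : ℝ} {g : ℕ → ℝ} (hg : ∀ x, M ≤ x → g x = 0)
    (he : ∀ x < M, c.op g x = (1 - l) * g x) {x : ℕ} (hx : x < M) :
    l * c.green M g x = g x := by
  have h := c.dot_green_of_eigen hM hg he (h := Pi.single x 1)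
    fun y hy => Pi.single_eq_of_ne (by omega) _
  have hw := c.weight_pos (x := x) (by omega)
  have h1 : c.dot (Pi.single x 1) g = c.weight x * g x := by
    rw [dot, Finset.sum_eq_single x]
    · simp
    · intro y _ hy
      simp [hy]
    · intro h
      simp at h
      omega
  have h2 (z : ℕ) : c.green M (Pi.single x 1) z = c.weight x * c.res M (max z x) := by
    rw [green, Finset.sum_eq_single x]
    · simp
    · intro y _ hy
      simp [hy]
    · intro h
      simp at h
      omega
  have h3 : c.dot (c.green M (Pi.single x 1)) g = c.weight x * c.green M g x := by
    rw [c.dot_eq_of_le hM (fun y hy => c.green_of_le _ hy), green, Finset.mul_sum]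
    refine Finset.sum_congr rfl fun y _ => ?_
    rw [h2, max_comm]
    ring
  rw [h1, h3] at h
  refine mul_left_cancel₀ hw.ne' ?_
  linarith

theorem dot_green_self {M : ℕ} (hM : M ≤ n) (g : ℕ → ℝ) :
    c.dot (c.green M g) g = c.greenForm M g := by
  rw [c.dot_eq_of_le hM (fun y hy => c.green_of_le _ hy), greenForm]
  refine Finset.sum_congr rfl fun x _ => ?_
  rw [green, Finset.sum_mul, Finset.mul_sum]
  exact Finset.sum_congr rfl fun y _ => by ring

theorem dot_self_pos {M : ℕ} (hM : M ≤ n) {g : ℕ → ℝ} {x : ℕ} (hx : x < M) (h : g x ≠ 0) :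
    0 < c.dot g g := by
  refine Finset.sum_pos' (fun y _ => mul_nonneg (c.weight_nonneg y) (mul_self_nonneg _))
    ⟨x, Finset.mem_range.2 (by omega), ?_⟩
  exact mul_pos (c.weight_pos (by omega)) (mul_self_pos.2 h)

theorem eigenvalue_pos {M : ℕ} (hM : M ≤ n) {l : ℝ} {g : ℕ → ℝ} (hg : ∀ x, M ≤ x → g x = 0)
    (he : ∀ x < M, c.op g x = (1 - l) * g x) {x : ℕ} (hx : x < M) (h : g x ≠ 0) : 0 < l := by
  have h1 := c.dot_green_of_eigen hM hg he hg
  rw [c.dot_green_self hM] at h1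
  by_contra! hl
  have := mul_nonpos_of_nonpos_of_nonneg hl (c.greenForm_nonneg M g)
  linarith [c.dot_self_pos hM hx h]

theorem one_le_sq_mul_var {M : ℕ} (hM : M ≤ n) {l : ℝ} {g : ℕ → ℝ} (hg : ∀ x, M ≤ x → g x = 0)
    (he : ∀ x < M, c.op g x = (1 - l) * g x) {x : ℕ} (hx : x < M) (h : g x ≠ 0) :
    1 ≤ l ^ 2 * c.var M := by
  have h1 := c.dot_green_of_eigen hM hg he hg
  rw [c.dot_green_self hM] at h1
  have h2 := c.dot_self_pos hM hx h
  have h3 : c.greenForm M g ^ 2 ≤ c.var M * c.dot g g ^ 2 := by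
    have e : c.dot g g ^ 2 = ∑ p ∈ Finset.range M ×ˢ Finset.range M,
        c.weight p.1 * c.weight p.2 * (g p.1 * g p.2) ^ 2 := by
      rw [c.dot_eq_of_le hM hg, sq, Finset.sum_mul_sum, Finset.sum_product]
      exact Finset.sum_congr rfl fun x _ => Finset.sum_congr rfl fun y _ => by ring
    rw [e, var_eq, greenForm, ← Finset.sum_product', ← Finset.sum_product']
    have hw (p : ℕ × ℕ) : 0 ≤ c.weight p.1 * c.weight p.2 :=
      mul_nonneg (c.weight_nonneg _) (c.weight_nonneg _)
    exact Finset.sum_sq_le_sum_mul_sum_of_sq_le_mul _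
      (fun p _ => mul_nonneg (hw p) (sq_nonneg _)) (fun p _ => mul_nonneg (hw p) (sq_nonneg _))
      fun p _ => le_of_eq (by ring)
  have h4 : c.dot g g ^ 2 ≤ l ^ 2 * c.var M * c.dot g g ^ 2 := by
    calc c.dot g g ^ 2 = l ^ 2 * c.greenForm M g ^ 2 := by rw [← h1]; ring
      _ ≤ l ^ 2 * (c.var M * c.dot g g ^ 2) := mul_le_mul_of_nonneg_left h3 (sq_nonneg l)
      _ = _ := by ring
  by_contra! hcon
  nlinarith [pow_pos h2 2]

/-- The Schur test for the Green operator. -/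
theorem mul_greenForm_le {M : ℕ} (hM : M ≤ n) {l : ℝ} {g : ℕ → ℝ} (hg : ∀ x, M ≤ x → g x = 0)
    (he : ∀ x < M, c.op g x = (1 - l) * g x) (hp : ∀ x < M, 0 < g x) (hl : 0 < l) (f : ℕ → ℝ) :
    l * c.greenForm M f ≤ ∑ x ∈ Finset.range M, c.weight x * f x ^ 2 := by
  have h1 : c.greenForm M f ≤ ∑ x ∈ Finset.range M, ∑ y ∈ Finset.range M,
      c.weight x * c.weight y * c.res M (max x y) * (f x ^ 2 * (g y / g x)) := by
    have h2 : ∑ x ∈ Finset.range M, ∑ y ∈ Finset.range M,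
        c.weight x * c.weight y * c.res M (max x y) * (f x ^ 2 * (g y / g x))
        = ∑ x ∈ Finset.range M, ∑ y ∈ Finset.range M,
        c.weight x * c.weight y * c.res M (max x y) *
          ((f x ^ 2 * (g y / g x) + f y ^ 2 * (g x / g y)) / 2) := by
      have h3 : ∑ x ∈ Finset.range M, ∑ y ∈ Finset.range M,
          c.weight x * c.weight y * c.res M (max x y) * (f x ^ 2 * (g y / g x))
          = ∑ x ∈ Finset.range M, ∑ y ∈ Finset.range M,
          c.weight x * c.weight y * c.res M (max x y) * (f y ^ 2 * (g x / g y)) := by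
        rw [Finset.sum_comm]
        refine Finset.sum_congr rfl fun x _ => Finset.sum_congr rfl fun y _ => ?_
        rw [max_comm]
        ring
      have h4 : ∀ a b : ℝ, a = b → a = (a + b) / 2 := fun a b h => by linarith
      rw [h4 _ _ h3]
      simp only [← Finset.sum_add_distrib, Finset.sum_div]
      exact Finset.sum_congr rfl fun x _ => Finset.sum_congr rfl fun y _ => by ring
    rw [h2]
    refine Finset.sum_le_sum fun x hx => Finset.sum_le_sum fun y hy => ?_
    refine mul_le_mul_of_nonneg_left ?_
      (mul_nonneg (mul_nonneg (c.weight_nonneg x) (c.weight_nonneg y)) (c.res_nonneg _ _))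
    have gx := hp x (Finset.mem_range.1 hx)
    have gy := hp y (Finset.mem_range.1 hy)
    rw [← sub_nonneg]
    have : (f x ^ 2 * (g y / g x) + f y ^ 2 * (g x / g y)) / 2 - f x * f y
        = (f x * g y - f y * g x) ^ 2 / (2 * (g x * g y)) := by
      field_simp
      ring
    rw [this]
    positivity
  refine (mul_le_mul_of_nonneg_left h1 hl.le).trans_eq ?_
  rw [Finset.mul_sum]
  refine Finset.sum_congr rfl fun x hx => ?_
  have gx := hp x (Finset.mem_range.1 hx)
  have h5 := c.eigen_green hM hg he (Finset.mem_range.1 hx)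
  calc _ = c.weight x * f x ^ 2 / g x * (l * c.green M g x) := by
        rw [green, Finset.mul_sum, Finset.mul_sum, Finset.mul_sum]
        exact Finset.sum_congr rfl fun y _ => by ring
    _ = _ := by
        rw [h5]
        field_simp

theorem mul_var_le_mean {M : ℕ} (hM : M ≤ n) {l : ℝ} {g : ℕ → ℝ} (hg : ∀ x, M ≤ x → g x = 0)
    (he : ∀ x < M, c.op g x = (1 - l) * g x) (hp : ∀ x < M, 0 < g x) (hl : 0 < l) :
    l * c.var M ≤ c.mean M := by
  rw [var_eq_sum_greenForm, mean_eq_sum, Finset.mul_sum]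
  refine Finset.sum_le_sum fun k _ => ?_
  rw [mul_left_comm]
  exact mul_le_mul_of_nonneg_left (c.mul_greenForm_le hM hg he hp hl _)
    (inv_nonneg.2 (mul_nonneg (c.weight_nonneg k) (c.up_nonneg k)))

end BDChain

namespace BDChain

variable {n : ℕ} (c : BDChain n)

/-- The solution of `(I - K) f = s f` with `f 0 = 1`. -/
def shoot (s : ℝ) : ℕ → ℝ
  | 0 => 1
  | 1 => (1 - s - c.stay 0) / c.up 0
  | x + 2 =>
    ((1 - s - c.stay (x + 1)) * shoot s (x + 1) - c.down (x + 1) * shoot s x) / c.up (x + 1)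

theorem op_shoot (s : ℝ) {x : ℕ} (hx : x < n) :
    c.op (c.shoot s) x = (1 - s) * c.shoot s x := by
  have h := c.up_pos hx
  rw [op_apply]
  rcases x with _ | x
  · simp only [shoot, c.down_zero]
    field_simp
    ring
  · rw [Nat.add_sub_cancel, show x + 1 + 1 = x + 2 from rfl, shoot]
    field_simp
    ring

theorem continuous_shoot (x : ℕ) : Continuous fun s => c.shoot s x := by
  suffices h : (Continuous fun s => c.shoot s x) ∧ Continuous fun s => c.shoot s (x + 1) from h.1
  induction x with
  | zero =>
    constructor
    · simp only [shoot]
      fun_prop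
    · simp only [shoot]
      fun_prop
  | succ x ih =>
    obtain ⟨h1, h2⟩ := ih
    refine ⟨h2, ?_⟩
    simp only [shoot]
    fun_prop

theorem eq_zero_of_op_eq {M : ℕ} (hM : M ≤ n) {s : ℝ} {g : ℕ → ℝ} (h0 : g 0 = 0)
    (he : ∀ x < M, c.op g x = (1 - s) * g x) {x : ℕ} (hx : x ≤ M) : g x = 0 := by
  induction x using Nat.strong_induction_on with
  | _ x ih =>
    rcases x with _ | x
    · exact h0
    · have h := he x (by omega)
      have hu := c.up_pos (x := x) (by omega)
      rw [op_apply, ih x (by omega) (by omega), ih (x - 1) (by omega) (by omega)] at h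
      simpa [hu.ne'] using h

theorem eq_mul_shoot {M : ℕ} (hM : M ≤ n) {s : ℝ} {g : ℕ → ℝ}
    (he : ∀ x < M, c.op g x = (1 - s) * g x) {x : ℕ} (hx : x ≤ M) :
    g x = g 0 * c.shoot s x := by
  have h := c.eq_zero_of_op_eq hM (s := s) (g := g - g 0 • c.shoot s) (by simp [shoot])
    (fun x hx => by
      rw [map_sub, map_smul, Pi.sub_apply, Pi.smul_apply, he x hx, c.op_shoot s (by omega)]
      simp only [Pi.sub_apply, Pi.smul_apply, smul_eq_mul]
      ring) hx
  simp only [Pi.sub_apply, Pi.smul_apply, smul_eq_mul] at h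
  linarith

theorem shoot_zero {x : ℕ} (hx : x ≤ n) : c.shoot 0 x = 1 := by
  have h := c.eq_mul_shoot le_rfl (s := 0) (g := 1) (fun x hx => by
    rw [op_apply]
    simpa using c.rates_sum hx.le) hx
  simpa using h.symm

theorem shoot_pos_of_nonneg {M : ℕ} (hM : M ≤ n) {s : ℝ} (h : ∀ x ≤ M, 0 ≤ c.shoot s x) {x : ℕ}
    (hx : x < M) : 0 < c.shoot s x := by
  refine lt_of_le_of_ne (h x hx.le) fun h0 => ?_
  have hz : ∀ y ≤ x, c.shoot s y = 0 := by
    intro y hy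
    induction hy using Nat.decreasingInduction with
    | self => exact h0.symm
    | of_succ y hy ih =>
      have h1 := c.op_shoot s (x := y + 1) (by omega)
      rw [op_apply, ih, Nat.add_sub_cancel] at h1
      have h2 := mul_nonneg (c.up_nonneg (y + 1)) (h (y + 1 + 1) (by omega))
      have h3 := mul_nonneg (c.down_nonneg (y + 1)) (h y (by omega))
      have h4 : c.down (y + 1) * c.shoot s y = 0 := by linarith
      exact (mul_eq_zero.1 h4).resolve_left (c.down_pos (by omega)).ne'
  have := hz 0 (Nat.zero_le x)
  simp [shoot] at this

theorem subIK_mulVec (M : Fin (n + 1)) {g : ℕ → ℝ} (hg : ∀ x, (M : ℕ) ≤ x → g x = 0)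
    (i : Fin (M : ℕ)) : (c.subIK M *ᵥ fun j => g j) i = g i - c.op g i := by
  have h1 : c.op g i = ∑ j : Fin (M : ℕ),
      c.K (Fin.castLE M.isLt.le i) (Fin.castLE M.isLt.le j) * g j := by
    refine (c.sum_K_mul (Fin.castLE M.isLt.le i) g).symm.trans ?_
    refine Eq.trans (Finset.sum_subset
      (Finset.subset_univ (Finset.univ.map (Fin.castLEEmb M.isLt.le)))
      fun j _ hj => ?_).symm ?_
    · rw [hg, mul_zero]
      by_contra! hlt
      exact hj (Finset.mem_map.2 ⟨⟨j, hlt⟩, Finset.mem_univ _, rfl⟩)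
    · rw [Finset.sum_map]
      rfl
  rw [h1, mulVec, dotProduct]
  simp only [subIK, of_apply, Matrix.sub_apply, sub_mul, Finset.sum_sub_distrib]
  congr 1
  rw [Finset.sum_eq_single i]
  · simp
  · intro j _ hj
    rw [Matrix.one_apply_ne, zero_mul]
    exact fun h => hj (Fin.castLE_injective _ h).symm
  · simp

theorem mem_eigSet_iff (M : Fin (n + 1)) (l : ℝ) :
    l ∈ eigSet (c.subIK M) ↔ ∃ g : ℕ → ℝ, (∃ x < (M : ℕ), g x ≠ 0) ∧
      (∀ x, (M : ℕ) ≤ x → g x = 0) ∧ ∀ x < (M : ℕ), c.op g x = (1 - l) * g x := by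
  constructor
  · rintro ⟨v, hv, he⟩
    obtain ⟨i, hi⟩ := Function.ne_iff.1 hv
    set g : ℕ → ℝ := fun x => if h : x < (M : ℕ) then v ⟨x, h⟩ else 0 with hgdef
    have hgv : (fun j : Fin (M : ℕ) => g j) = v := by
      ext j
      simp [hgdef]
    have hg0 : ∀ x, (M : ℕ) ≤ x → g x = 0 := fun x hx => dif_neg (by omega)
    refine ⟨g, ⟨i, i.2, ?_⟩, hg0, fun x hx => ?_⟩
    · rw [← hgv] at hi
      exact hi
    · have h := c.subIK_mulVec M hg0 ⟨x, hx⟩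
      rw [hgv, he, ← hgv] at h
      simp only [Pi.smul_apply, smul_eq_mul] at h
      linarith
  · rintro ⟨g, ⟨x, hx, hgx⟩, hg0, he⟩
    refine ⟨fun j => g j, fun h => hgx (congrFun h ⟨x, hx⟩), ?_⟩
    ext i
    rw [c.subIK_mulVec M hg0, he i i.2]
    simp only [Pi.smul_apply, smul_eq_mul]
    ring

/-- The smallest eigenvalue has a positive eigenfunction. -/
theorem exists_pos_eigenfunction {M : Fin (n + 1)} {l : ℝ}
    (h : IsSmallestEig (c.subIK M) l) :
    0 < l ∧ ∃ g : ℕ → ℝ, (∀ x < (M : ℕ), 0 < g x) ∧ (∀ x, (M : ℕ) ≤ x → g x = 0) ∧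
      ∀ x < (M : ℕ), c.op g x = (1 - l) * g x := by
  have hM : (M : ℕ) ≤ n := Nat.lt_succ_iff.1 M.2
  obtain ⟨hl, hmin⟩ := h
  obtain ⟨g, ⟨x, hx, hgx⟩, hg0, he⟩ := (c.mem_eigSet_iff M l).1 hl
  have hlpos : 0 < l := c.eigenvalue_pos hM hg0 he hx hgx
  have hlM : c.shoot l M = 0 := by
    have h1 := c.eq_mul_shoot hM he hx.le
    have h2 := c.eq_mul_shoot hM he le_rfl
    rw [hg0 M le_rfl] at h2
    refine (mul_eq_zero.1 h2.symm).resolve_left fun h0 => hgx ?_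
    rw [h1, h0, zero_mul]
  set A : Set ℝ := {s | 0 ≤ s ∧ ∃ x ∈ Finset.range (M + 1), c.shoot s x ≤ 0} with hA
  have hAcl : IsClosed A := by
    have : A = Set.Ici 0 ∩ ⋃ x ∈ Finset.range (M + 1), {s | c.shoot s x ≤ 0} := by
      ext s
      simp [hA]
    rw [this]
    exact isClosed_Ici.inter (isClosed_biUnion_finset fun x _ =>
      isClosed_le (c.continuous_shoot x) continuous_const)
  have hAbdd : BddBelow A := ⟨0, fun s hs => hs.1⟩
  have hlA : l ∈ A := ⟨hlpos.le, M, by simp, hlM.le⟩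
  set m : ℝ := sInf A with hm
  have hmA : m ∈ A := hAcl.csInf_mem ⟨l, hlA⟩ hAbdd
  have hml : m ≤ l := csInf_le hAbdd hlA
  have hm0 : 0 < m := by
    refine lt_of_le_of_ne hmA.1 fun h0 => ?_
    obtain ⟨y, hy, hy'⟩ := hmA.2
    rw [← h0, c.shoot_zero (by have := Finset.mem_range.1 hy; omega)] at hy'
    linarith
  have hnn : ∀ y ≤ (M : ℕ), 0 ≤ c.shoot m y := by
    intro y hy
    have hcl : IsClosed {s | 0 ≤ c.shoot s y} := isClosed_le continuous_const (c.continuous_shoot y)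
    have hsub : Set.Ico 0 m ⊆ {s | 0 ≤ c.shoot s y} := fun s hs => by
      by_contra! hneg
      have : s ∈ A := ⟨hs.1, y, Finset.mem_range.2 (by omega), (not_le.1 hneg).le⟩
      exact absurd (csInf_le hAbdd this) (not_le.2 hs.2)
    have := hcl.closure_subset_iff.2 hsub
    rw [closure_Ico hm0.ne] at this
    exact this ⟨hm0.le, le_rfl⟩
  have hpos : ∀ y < (M : ℕ), 0 < c.shoot m y := fun y hy => c.shoot_pos_of_nonneg hM hnn hy
  have hmM : c.shoot m M = 0 := by
    obtain ⟨y, hy, hy'⟩ := hmA.2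
    rcases (Nat.lt_succ_iff.1 (Finset.mem_range.1 hy)).eq_or_lt with rfl | hlt
    · exact le_antisymm hy' (hnn _ le_rfl)
    · exact absurd hy' (not_le.2 (hpos y hlt))
  have hg : ∃ g : ℕ → ℝ, (∀ x < (M : ℕ), 0 < g x) ∧ (∀ x, (M : ℕ) ≤ x → g x = 0) ∧
      ∀ x < (M : ℕ), c.op g x = (1 - m) * g x := by
    have he' : ∀ x ≤ (M : ℕ), (if x < (M : ℕ) then c.shoot m x else 0) = c.shoot m x := by
      intro x hx
      split_ifs with hlt
      · rfl
      · rw [show x = M by omega, hmM]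
    refine ⟨fun x => if x < (M : ℕ) then c.shoot m x else 0, fun x hx => ?_, fun x hx => ?_,
      fun x hx => ?_⟩
    · exact (hpos x hx).trans_eq (he' x hx.le).symm
    · exact if_neg (by omega)
    · rw [op_apply]
      beta_reduce
      rw [he' x hx.le, he' (x - 1) (by omega), he' (x + 1) hx, ← op_apply, c.op_shoot m (by omega)]
  have hlm : m = l := by
    refine le_antisymm hml (hmin m ((c.mem_eigSet_iff M m).2 ?_))
    obtain ⟨g, h1, h2, h3⟩ := hg
    exact ⟨g, ⟨x, hx, (h1 x hx).ne'⟩, h2, h3⟩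
  exact ⟨hlpos, hlm ▸ hg⟩

/-- The transition function of the lazy killed chain, normalized by a positive eigenfunction, is
decreasing. -/
theorem lazy_killedOp_pow_div_antitone {M : ℕ} (hM : M ≤ n) {l : ℝ} {g : ℕ → ℝ}
    (hp : ∀ x < M, 0 < g x) (hg : ∀ x, M ≤ x → g x = 0)
    (he : ∀ x < M, c.op g x = (1 - l) * g x) (hl : 0 < l) (m : ℕ) {x : ℕ} (hx : x + 1 < M) :
    (lazyOp (c.killedOp M) ^ m) (Pi.single 0 1) (x + 1) / g (x + 1)
      ≤ (lazyOp (c.killedOp M) ^ m) (Pi.single 0 1) x / g x := by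
  set T := tridiagOp (fun x => c.up x * g (x + 1) / (2 * g x))
    (fun x => c.down x * g (x - 1) / (2 * g x)) (fun x => (1 + c.stay x) / 2) with hT
  have gnn (y : ℕ) : 0 ≤ g y := by
    rcases Nat.lt_or_ge y M with h | h
    · exact (hp y h).le
    · exact (hg y h).ge
  have hd0 : ∀ x, M ≤ x → (Pi.single 0 1 : ℕ → ℝ) x = 0 := fun y hy =>
    Pi.single_eq_of_ne (by omega) _
  have hsupp (m : ℕ) := (c.dot_lazy_killedOp_pow hM hd0 hd0 m).2
  have hstep (m x : ℕ) (hx : x < M) :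
      (lazyOp (c.killedOp M) ^ (m + 1)) (Pi.single 0 1) x / g x
        = T (fun y => (lazyOp (c.killedOp M) ^ m) (Pi.single 0 1) y / g y) x := by
    have hc (y : ℕ) (hy : y ≤ M) : g y * ((lazyOp (c.killedOp M) ^ m) (Pi.single 0 1) y / g y)
        = (lazyOp (c.killedOp M) ^ m) (Pi.single 0 1) y := by
      rcases hy.eq_or_lt with rfl | hlt
      · rw [hsupp m y le_rfl, hg y le_rfl, zero_mul]
      · have := (hp y hlt).ne'
        field_simp
    have h1 := hc (x - 1) (by omega)
    have h2 := hc (x + 1) hx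
    have h3 := (hp x hx).ne'
    rw [hT, tridiagOp_apply, pow_succ', Module.End.mul_apply, lazyOp_apply, killedOp_apply,
      if_pos hx, op_apply, ← h1, ← h2]
    field_simp
    ring
  obtain ⟨N, rfl⟩ : ∃ N, M = N + 1 := ⟨M - 1, by omega⟩
  have hsum (x : ℕ) (hx : x < N + 1) :
      c.down x * g (x - 1) / (2 * g x) + (1 + c.stay x) / 2 + c.up x * g (x + 1) / (2 * g x)
        = 1 - l / 2 := by
    have h1 := he x hx
    have h2 := hp x hx
    rw [op_apply] at h1
    field_simp
    linarith
  have hup (x : ℕ) : 0 ≤ c.up x * g (x + 1) / (2 * g x) :=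
    div_nonneg (mul_nonneg (c.up_nonneg x) (gnn _)) (by linarith [gnn x])
  have hdown (x : ℕ) : 0 ≤ c.down x * g (x - 1) / (2 * g x) :=
    div_nonneg (mul_nonneg (c.down_nonneg x) (gnn _)) (by linarith [gnn x])
  suffices h : ∀ x < N, (lazyOp (c.killedOp (N + 1)) ^ m) (Pi.single 0 1) (x + 1) / g (x + 1)
      ≤ (lazyOp (c.killedOp (N + 1)) ^ m) (Pi.single 0 1) x / g x from h x (by omega)
  clear hx x
  induction m with
  | zero =>
    intro x hx
    rw [pow_zero, Module.End.one_apply, Pi.single_eq_of_ne (by omega), zero_div]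
    exact div_nonneg ((Pi.single_nonneg.2 (zero_le_one (α := ℝ)) : (0 : ℕ → ℝ) ≤ Pi.single 0 1) x)
      (gnn x)
  | succ m ih =>
    intro x hx
    rw [hstep m (x + 1) (by omega), hstep m x (by omega)]
    refine tridiagOp_antitone (N := N) (θ := 1 - l / 2) (fun x _ => hup x) (fun x _ => hdown x) ?_
      (fun x hx => hsum x (by omega)) (fun x hx => ?_) ih x hx
    · rw [hg (N + 1) le_rfl, mul_zero, zero_div]
    · linarith [hsum x (by omega), hsum (x + 1) (by omega), hup (x + 1), hdown x,
        c.stay_nonneg x, c.stay_nonneg (x + 1)]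

theorem lazy_killedOp_pow_decay {M : ℕ} (hM : M ≤ n) (h0 : 0 < M) {l : ℝ} {g : ℕ → ℝ}
    (hp : ∀ x < M, 0 < g x) (hg : ∀ x, M ≤ x → g x = 0)
    (he : ∀ x < M, c.op g x = (1 - l) * g x) (hl : 0 < l) (m : ℕ) :
    (lazyOp (c.killedOp M) ^ m) (below M) 0 - (lazyOp (c.killedOp M) ^ (m + 1)) (below M) 0
      ≤ l / 2 * (lazyOp (c.killedOp M) ^ m) (below M) 0 := by
  obtain ⟨N, rfl⟩ : ∃ N, M = N + 1 := ⟨M - 1, by omega⟩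
  set L := lazyOp (c.killedOp (N + 1)) with hL
  have hb : ∀ x, N + 1 ≤ x → below (N + 1) x = 0 := fun x hx => below_of_le hx
  have hd0 : ∀ x, N + 1 ≤ x → (Pi.single 0 1 : ℕ → ℝ) x = 0 := fun y hy =>
    Pi.single_eq_of_ne (by omega) _
  have w0 := c.weight_pos (Nat.zero_le n)
  set ρ := (L ^ m) (Pi.single 0 1) with hρ
  have hρ0 : ∀ x, N + 1 ≤ x → ρ x = 0 := (c.dot_lazy_killedOp_pow hM hd0 hd0 m).2
  have hdot (f : ℕ → ℝ) : c.dot (Pi.single 0 1) f = c.weight 0 * f 0 := by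
    rw [dot, Finset.sum_eq_single 0]
    · simp
    · intro y _ hy
      simp [hy]
    · simp
  have hTb : below (N + 1) - L (below (N + 1))
      = (1 / 2 * c.up N) • (Pi.single N 1 : ℕ → ℝ) := by
    ext x
    rw [Pi.sub_apply, Pi.smul_apply, hL, lazyOp_apply, killedOp_apply, smul_eq_mul]
    rcases lt_trichotomy x N with hx | rfl | hx
    · rw [if_pos (by omega), op_apply, below_of_lt (by omega), below_of_lt (by omega),
        below_of_lt (by omega), Pi.single_eq_of_ne hx.ne]
      linarith [c.rates_sum (x := x) (by omega)]
    · rw [if_pos (by omega), op_apply, below_of_lt (by omega), below_of_lt (by omega),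
        below_of_le (by omega), Pi.single_eq_same]
      linarith [c.rates_sum (x := x) (by omega)]
    · rw [if_neg (by omega), below_of_le (by omega), Pi.single_eq_of_ne hx.ne']
      ring
  have hdotN (f : ℕ → ℝ) : c.dot f (Pi.single N 1) = c.weight N * f N := by
    rw [dot, Finset.sum_eq_single N]
    · simp
    · intro y _ hy
      simp [hy]
    · intro h
      simp at h
      omega
  have hLb : ∀ x, N + 1 ≤ x → L (below (N + 1)) x = 0 := by
    have := (c.dot_lazy_killedOp_pow hM hb hb 1).2
    rwa [pow_one] at this
  have e1 : c.weight 0 * (L ^ m) (below (N + 1)) 0 = c.dot ρ (below (N + 1)) := by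
    rw [← hdot, (c.dot_lazy_killedOp_pow hM hd0 hb m).1]
  have e2 : c.weight 0 * (L ^ (m + 1)) (below (N + 1)) 0 = c.dot ρ (L (below (N + 1))) := by
    rw [← hdot, pow_succ, Module.End.mul_apply, (c.dot_lazy_killedOp_pow hM hd0 hLb m).1]
  have e3 : c.weight 0 * ((L ^ m) (below (N + 1)) 0 - (L ^ (m + 1)) (below (N + 1)) 0)
      = 1 / 2 * (c.weight N * c.up N * ρ N) := by
    rw [mul_sub, e1, e2, ← dot_sub, hTb, dot_smul, hdotN]
    ring
  have hgk : g - L g = (l / 2) • g := by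
    ext x
    rw [Pi.sub_apply, Pi.smul_apply, hL, lazyOp_apply, killedOp_apply, smul_eq_mul]
    split_ifs with hx
    · rw [he x hx]
      ring
    · rw [hg x (by omega)]
      ring
  have e4 : l * c.dot g (below (N + 1)) = c.weight N * c.up N * g N := by
    have h1 := (c.dot_lazy_killedOp_pow hM hg hb 1).1
    rw [pow_one, ← hL] at h1
    have h2 : c.dot g (below (N + 1) - L (below (N + 1))) = c.dot (below (N + 1)) (g - L g) := by
      rw [dot_sub, dot_sub, h1, dot_comm, c.dot_comm (L g)]
    rw [hTb, hgk, dot_smul, dot_smul, hdotN, c.dot_comm _ g] at h2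
    linarith
  have hgN := hp N (by omega)
  have hanti : ∀ x ≤ N, ρ N / g N * g x ≤ ρ x := by
    intro x hx
    have h1 : ρ N / g N ≤ ρ x / g x := by
      induction hx using Nat.decreasingInduction with
      | self => exact le_rfl
      | of_succ y hy ih =>
        exact ih.trans (c.lazy_killedOp_pow_div_antitone hM hp hg he hl m (by omega))
    have hgx := hp x (by omega)
    rwa [le_div_iff₀ hgx] at h1
  have e5 : ρ N / g N * c.dot g (below (N + 1)) ≤ c.dot ρ (below (N + 1)) := by
    rw [c.dot_eq_of_le hM hg, c.dot_eq_of_le hM hρ0, Finset.mul_sum]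
    refine Finset.sum_le_sum fun x hx => ?_
    have hx' := Finset.mem_range.1 hx
    rw [below_of_lt hx', mul_one, mul_one, mul_left_comm]
    exact mul_le_mul_of_nonneg_left (hanti x (by omega)) (c.weight_nonneg x)
  have e6 : c.weight N * c.up N * ρ N ≤ l * c.dot ρ (below (N + 1)) := by
    calc _ = ρ N / g N * (c.weight N * c.up N * g N) := by field_simp
      _ = l * (ρ N / g N * c.dot g (below (N + 1))) := by rw [← e4]; ring
      _ ≤ _ := mul_le_mul_of_nonneg_left e5 hl.le
  rw [← e1] at e6
  refine le_of_mul_le_mul_left ?_ w0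
  rw [e3]
  linarith

/-- The hazard rate of the hitting time is at most the smallest eigenvalue. -/
theorem exp_mul_surv_le {M : Fin (n + 1)} (h0 : 0 < (M : ℕ)) {l : ℝ}
    (h : IsSmallestEig (c.subIK M) l) {s r : ℝ} (hs : 0 ≤ s) (hr : 0 ≤ r) :
    Real.exp (-(l * r)) * c.surv M s ≤ c.surv M (s + r) := by
  have hM : (M : ℕ) ≤ n := Nat.lt_succ_iff.1 M.2
  obtain ⟨hl, g, hp, hg, he⟩ := c.exists_pos_eigenfunction h
  set a : ℕ → ℝ := fun m => (lazyOp (c.killedOp M) ^ m) (below M) 0 with ha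
  have hab : ∀ m, |a m| ≤ 1 := fun m =>
    (c.isSubMarkov_killedOp M).lazy.abs_pow_le (abs_below_le M) m 0
  have hS (t : ℝ) : c.surv M t = poissonMix a (2 * t) := c.surv_eq_lazy M t
  have hd (t : ℝ) : HasDerivAt (c.surv M)
      (2 * poissonMix (fun m => a (m + 1) - a m) (2 * t)) t := by
    have h1 := (poissonMix.hasDerivAt hab (2 * t)).comp t ((hasDerivAt_id t).const_mul 2)
    rw [funext hS]
    refine h1.congr_deriv ?_
    ring
  have hle (t : ℝ) (ht : 0 ≤ t) :
      -(l * c.surv M t) ≤ 2 * poissonMix (fun m => a (m + 1) - a m) (2 * t) := by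
    have : poissonMix (fun m => -(l / 2) * a m) (2 * t)
        ≤ poissonMix (fun m => a (m + 1) - a m) (2 * t) := by
      refine poissonMix.mono (C := l / 2) (D := 2) (fun m => ?_) (fun m => ?_) (fun m => ?_)
        (by linarith)
      · rw [abs_mul, abs_neg, abs_of_pos (by linarith)]
        exact mul_le_of_le_one_right (by linarith) (hab m)
      · refine (abs_sub _ _).trans ?_
        linarith [hab m, hab (m + 1)]
      · have := c.lazy_killedOp_pow_decay hM h0 hp hg he hl m
        simp only [ha]
        linarith
    rw [poissonMix.const_mul, ← hS] at this
    linarith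
  have hmono := sub_le_sub_of_hasDerivAt_le (a := s) (b := s + r) (by linarith)
    (fun t => hasDerivAt_const t (0 : ℝ))
    (fun t => (((hasDerivAt_id t).const_mul l).exp).mul (hd t)) fun t ht _ => by
      have := mul_le_mul_of_nonneg_left (hle t (hs.trans ht)) (Real.exp_pos (l * id t)).le
      linarith
  simp only [id, Pi.mul_apply] at hmono
  have e : Real.exp (l * (s + r)) = Real.exp (l * s) * Real.exp (l * r) := by
    rw [← Real.exp_add]
    ring_nf
  have h2 : Real.exp (l * s) * c.surv M s
      ≤ Real.exp (l * s) * (Real.exp (l * r) * c.surv M (s + r)) := by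
    rw [e] at hmono
    linarith
  have h3 := le_of_mul_le_mul_left h2 (Real.exp_pos _)
  rw [Real.exp_neg, inv_mul_le_iff₀ (Real.exp_pos _)]
  exact h3

theorem smallestEig_spec {M : Fin (n + 1)} (h0 : 0 < (M : ℕ)) {l : ℝ}
    (h : IsSmallestEig (c.subIK M) l) :
    0 < l ∧ 1 ≤ l ^ 2 * c.var M ∧ l * c.var M ≤ c.mean M := by
  have hM : (M : ℕ) ≤ n := Nat.lt_succ_iff.1 M.2
  obtain ⟨hl, g, hp, hg, he⟩ := c.exists_pos_eigenfunction h
  exact ⟨hl, c.one_le_sq_mul_var hM hg he h0 (hp 0 h0).ne', c.mul_var_le_mean hM hg he hp hl⟩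

end BDChain

namespace BDChain

variable {F : (n : ℕ) → BDChain n} {M : ℝ → (n : ℕ) → Fin (n + 1)}

theorem piLow_eq_low {n : ℕ} (c : BDChain n) (M : Fin (n + 1)) : c.piLow M = c.low (M + 1) := by
  have h := Finset.sum_range (n := n + 1) fun x => if x ≤ (M : ℕ) then c.weight x else 0
  rw [← Finset.sum_filter] at h
  rw [low, show Finset.range ((M : ℕ) + 1) = (Finset.range (n + 1)).filter (· ≤ (M : ℕ)) by
    ext x; simp only [Finset.mem_range, Finset.mem_filter]; omega, h, piLow]
  exact Finset.sum_congr rfl fun x _ => by simp only [weight_fin, Fin.le_def]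

theorem piHigh_eq_low {n : ℕ} (c : BDChain n) (M : Fin (n + 1)) : c.piHigh M = 1 - c.low M := by
  have h := Finset.sum_range (n := n + 1) fun x => if x < (M : ℕ) then c.weight x else 0
  rw [← Finset.sum_filter] at h
  rw [low, show Finset.range (M : ℕ) = (Finset.range (n + 1)).filter (· < (M : ℕ)) by
    ext x; simp only [Finset.mem_range, Finset.mem_filter]; omega, h, piHigh, ← c.pi_sum,
    ← Finset.sum_sub_distrib]
  refine Finset.sum_congr rfl fun x _ => ?_
  simp only [weight_fin, Fin.le_def]
  split_ifs <;> first | omega | simp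

/-- `M a n` is an `a`-quantile of the stationary distribution of the `n`-th chain, and is eventually
different from the left boundary state. -/
structure IsQuantile (F : (n : ℕ) → BDChain n) (M : ℝ → (n : ℕ) → Fin (n + 1)) : Prop where
  low_le : ∀ a ∈ Set.Ioo (0 : ℝ) 1, ∀ n, (F n).low (M a n) ≤ a
  le_low_succ : ∀ a ∈ Set.Ioo (0 : ℝ) 1, ∀ n, a ≤ (F n).low (M a n + 1)
  eventually_pos : ∀ a ∈ Set.Ioo (0 : ℝ) 1, ∀ᶠ n in atTop, 0 < (M a n : ℕ)

theorem fin_le {n : ℕ} (M : Fin (n + 1)) : (M : ℕ) ≤ n := Nat.lt_succ_iff.1 M.isLt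

namespace IsQuantile

variable (hq : IsQuantile F M) {a b : ℝ} (ha : a ∈ Set.Ioo (0 : ℝ) 1) (hb : b ∈ Set.Ioo (0 : ℝ) 1)
include hq ha

include hb in
theorem mono (hab : a < b) (n : ℕ) : (M a n : ℕ) ≤ M b n := by
  by_contra! h
  have h1 := (F n).low_mono (Nat.succ_le_of_lt h)
  exact absurd (h1.trans (hq.low_le a ha n)) (not_le.2 (hab.trans_le (hq.le_low_succ b hb n)))

theorem eventually_one_le_mean : ∀ᶠ n in atTop, 1 ≤ (F n).mean (M a n) :=
  (hq.eventually_pos a ha).mono fun n h => (F n).one_le_mean (fin_le _) h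

theorem eventually_var_pos : ∀ᶠ n in atTop, 0 < (F n).var (M a n) :=
  (hq.eventually_pos a ha).mono fun n h => (F n).var_pos (fin_le _) h

end IsQuantile

theorem _root_.tendsto_div_one_of_eventually {T t : ℕ → ℝ} (ht : ∀ᶠ n in atTop, 0 < t n)
    (h : ∀ δ ∈ Set.Ioo (0 : ℝ) 1, ∀ᶠ n in atTop, (1 - δ) * t n ≤ T n ∧ T n ≤ (1 + δ) * t n) :
    Tendsto (fun n => T n / t n) atTop (nhds 1) := by
  refine Metric.tendsto_nhds.2 fun e he => ?_
  have hd : min (e / 2) (1 / 2) ∈ Set.Ioo (0 : ℝ) 1 :=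
    ⟨by positivity, (min_le_right _ _).trans_lt (by norm_num)⟩
  filter_upwards [ht, h _ hd] with n h0 h1
  have h2 := min_le_left (e / 2) (1 / 2)
  have h3 := (le_div_iff₀ h0).2 h1.1
  have h4 := (div_le_iff₀ h0).2 h1.2
  rw [Real.dist_eq, abs_lt]
  constructor <;> linarith

theorem _root_.eventually_of_tendsto_div_one {T t : ℕ → ℝ} (ht : ∀ᶠ n in atTop, 0 < t n)
    (h : Tendsto (fun n => T n / t n) atTop (nhds 1)) {δ : ℝ} (hδ : 0 < δ) :
    ∀ᶠ n in atTop, (1 - δ) * t n < T n ∧ T n < (1 + δ) * t n := by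
  filter_upwards [ht, h.eventually (Ioo_mem_nhds (a := 1 - δ) (b := 1 + δ) (by linarith)
    (by linarith))] with n h0 h1
  exact ⟨(lt_div_iff₀ h0).1 h1.1, (div_lt_iff₀ h0).1 h1.2⟩

section

variable (hq : IsQuantile F M)
include hq

/-- Concentration of the hitting times of all quantiles gives a cutoff. -/
theorem cutoffWith_of_surv {t : ℕ → ℝ} (ht : ∀ᶠ n in atTop, 0 < t n)
    (h1 : ∀ a ∈ Set.Ioo (0 : ℝ) 1, ∀ ε ∈ Set.Ioo (0 : ℝ) 1,
      Tendsto (fun n => (F n).surv (M a n) ((1 - ε) * t n)) atTop (nhds 1))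
    (h2 : ∀ a ∈ Set.Ioo (0 : ℝ) 1, ∀ ε > (0 : ℝ),
      Tendsto (fun n => (F n).surv (M a n) ((1 + ε) * t n)) atTop (nhds 0)) :
    cutoffWith (fun ε n => mixC ((F n).dTVC 0) ε) t := by
  intro e he
  refine tendsto_div_one_of_eventually ht fun δ hδ => ?_
  have ha : (1 - e) / 2 ∈ Set.Ioo (0 : ℝ) 1 := ⟨by linarith [he.2], by linarith [he.1]⟩
  have hb : 1 - e / 2 ∈ Set.Ioo (0 : ℝ) 1 := ⟨by linarith [he.2], by linarith [he.1]⟩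
  filter_upwards [ht, (h1 _ ha δ hδ).eventually_const_lt (u := (1 + e) / 2) (by linarith [he.2]),
    (h2 _ hb δ hδ.1).eventually_lt_const (u := e / 2) (by linarith [he.1])] with n h0 h3 h4
  have hmem : (1 + δ) * t n ∈ {s : ℝ | 0 ≤ s ∧ (F n).dTVC 0 s ≤ e} := by
    have hs : 0 ≤ (1 + δ) * t n := mul_nonneg (by linarith [hδ.1]) h0.le
    have h5 := (F n).dTVC_le_surv (fin_le (M (1 - e / 2) n)) hs
    have h6 := hq.le_low_succ _ hb n
    exact ⟨hs, by linarith⟩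
  refine ⟨le_csInf ⟨_, hmem⟩ fun s hs => ?_, csInf_le ⟨0, fun s hs => hs.1⟩ hmem⟩
  by_contra! hlt
  have h5 := (F n).surv_sub_le_dTVC (fin_le (M ((1 - e) / 2) n)) hs.1
  have h6 := hq.low_le _ ha n
  have h7 := (F n).surv_antitone (M ((1 - e) / 2) n) hs.1 hlt.le
  linarith [hs.2]

theorem tendsto_surv_one_of_cutoffWith {t : ℕ → ℝ} (ht : ∀ n, 0 < t n)
    (h : cutoffWith (fun ε n => mixC ((F n).dTVC 0) ε) t) {a : ℝ} (ha : a ∈ Set.Ioo (0 : ℝ) 1)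
    {ε : ℝ} (hε : ε ∈ Set.Ioo (0 : ℝ) 1) :
    Tendsto (fun n => (F n).surv (M a n) ((1 - ε) * t n)) atTop (nhds 1) := by
  have hnn (n : ℕ) : 0 ≤ (1 - ε) * t n := mul_nonneg (by linarith [hε.2]) (ht n).le
  refine tendsto_order.2 ⟨fun e he => ?_, fun e he => Eventually.of_forall fun n =>
    ((F n).surv_le_one _ (hnn n)).trans_lt he⟩
  obtain ⟨η, hη, hη1, hη2⟩ : ∃ η > 0, η < 1 ∧ η + η / a < 1 - e := by
    have hlim : Tendsto (fun η : ℝ => η + η / a) (nhdsWithin 0 (Set.Ioi 0)) (nhds 0) := by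
      have : Continuous fun η : ℝ => η + η / a := by fun_prop
      simpa using (this.tendsto 0).mono_left nhdsWithin_le_nhds
    have h1 : ∀ᶠ η : ℝ in nhdsWithin 0 (Set.Ioi 0), η < 1 :=
      (eventually_lt_nhds one_pos).filter_mono nhdsWithin_le_nhds
    obtain ⟨η, h1, h2, h3⟩ := (h1.and ((hlim.eventually_lt_const (sub_pos.2 he)).and
      self_mem_nhdsWithin)).exists
    exact ⟨η, h3, h1, h2⟩
  have h1 := h (1 - η) ⟨by linarith, by linarith⟩
  filter_upwards [eventually_of_tendsto_div_one (Eventually.of_forall ht) h1 hε.1] with n h2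
  have h3 : 1 - η < (F n).dTVC 0 ((1 - ε) * t n) := by
    by_contra! hle
    have hmem : (1 - ε) * t n ∈ {s : ℝ | 0 ≤ s ∧ (F n).dTVC 0 s ≤ 1 - η} := ⟨hnn n, hle⟩
    exact absurd (csInf_le ⟨0, fun s hs => hs.1⟩ hmem) (not_le.2 h2.1)
  have h4 := (F n).surv_ge_of_lt_dTVC (fin_le (M a n)) (hnn n) h3
  have h5 := div_le_div_of_nonneg_left hη.le ha.1 (hq.le_low_succ a ha n)
  linarith

theorem eventually_surv_le_of_cutoffWith {t : ℕ → ℝ} (ht : ∀ n, 0 < t n)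
    (h : cutoffWith (fun ε n => mixC ((F n).dTVC 0) ε) t) {a b : ℝ} (ha : a ∈ Set.Ioo (0 : ℝ) 1)
    (hab : a < b) (hb : b < 1) {ε : ℝ} (hε : 0 < ε) :
    ∀ᶠ n in atTop, (F n).surv (M a n) ((1 + ε) * t n) ≤ b := by
  have h1 := h (b - a) ⟨by linarith, by linarith [ha.1]⟩
  filter_upwards [eventually_of_tendsto_div_one (Eventually.of_forall ht) h1
    (δ := min ε (1 / 2)) (by positivity)] with n h2
  have hpos : 0 < mixC ((F n).dTVC 0) (b - a) := lt_of_le_of_lt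
    (mul_nonneg (by linarith [min_le_right ε (1 / 2)]) (ht n).le) h2.1
  have hne : {s : ℝ | 0 ≤ s ∧ (F n).dTVC 0 s ≤ b - a}.Nonempty := by
    by_contra hemp
    rw [Set.not_nonempty_iff_eq_empty] at hemp
    rw [mixC, hemp, Real.sInf_empty] at hpos
    exact hpos.false
  obtain ⟨s, hs, hlt⟩ := exists_lt_of_csInf_lt hne h2.2
  have h3 : s ≤ (1 + ε) * t n := hlt.le.trans
    (mul_le_mul_of_nonneg_right (by linarith [min_le_left ε (1 / 2)]) (ht n).le)
  have h4 := (F n).surv_antitone (M a n) hs.1 h3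
  have h5 := (F n).surv_sub_le_dTVC (fin_le (M a n)) hs.1
  linarith [hq.low_le a ha n, hs.2]

theorem tendsto_var_div_sq {a : ℝ} (ha : a ∈ Set.Ioo (0 : ℝ) 1)
    (h : Tendsto (fun n => (F n).mean (M a n) / √((F n).var (M a n))) atTop atTop) (ε : ℝ) :
    Tendsto (fun n => (F n).var (M a n) / (ε * (F n).mean (M a n)) ^ 2) atTop (nhds 0) := by
  have h1 := ((h.inv_tendsto_atTop).pow 2).mul_const ((ε ^ 2)⁻¹)
  rw [zero_pow two_ne_zero, zero_mul] at h1
  refine h1.congr' ?_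
  filter_upwards [hq.eventually_var_pos ha] with n h2
  rw [Pi.inv_apply, inv_div, div_pow, Real.sq_sqrt h2.le, mul_pow, div_mul_eq_mul_div,
    ← div_eq_mul_inv, div_div, mul_comm (ε ^ 2)]

theorem tendsto_surv_one_of_mean {a : ℝ} (ha : a ∈ Set.Ioo (0 : ℝ) 1)
    (h : Tendsto (fun n => (F n).mean (M a n) / √((F n).var (M a n))) atTop atTop)
    {ε : ℝ} (hε : ε ∈ Set.Ioo (0 : ℝ) 1) :
    Tendsto (fun n => (F n).surv (M a n) ((1 - ε) * (F n).mean (M a n))) atTop (nhds 1) := by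
  have h1 := (tendsto_var_div_sq hq ha h ε).const_sub 1
  rw [sub_zero] at h1
  refine tendsto_of_tendsto_of_tendsto_of_le_of_le' h1 tendsto_const_nhds ?_ ?_
  · filter_upwards [hq.eventually_one_le_mean ha] with n h2
    have h3 : 0 < ε * (F n).mean (M a n) := mul_pos hε.1 (by linarith)
    have h4 := (F n).chebyshev_lower (fin_le (M a n)) h3.le (by nlinarith [hε.2])
    rw [← le_div_iff₀' (by positivity)] at h4
    rw [show (1 - ε) * (F n).mean (M a n) = (F n).mean (M a n) - ε * (F n).mean (M a n) by ring]
    linarith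
  · exact Eventually.of_forall fun n => (F n).surv_le_one _
      (mul_nonneg (by linarith [hε.2]) ((F n).mean_nonneg _))

theorem tendsto_surv_zero_of_mean {a : ℝ} (ha : a ∈ Set.Ioo (0 : ℝ) 1)
    (h : Tendsto (fun n => (F n).mean (M a n) / √((F n).var (M a n))) atTop atTop)
    {ε : ℝ} (hε : 0 < ε) :
    Tendsto (fun n => (F n).surv (M a n) ((1 + ε) * (F n).mean (M a n))) atTop (nhds 0) := by
  refine tendsto_of_tendsto_of_tendsto_of_le_of_le' tendsto_const_nhds
    (tendsto_var_div_sq hq ha h ε) ?_ ?_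
  · exact Eventually.of_forall fun n => (F n).surv_nonneg _
      (mul_nonneg (by linarith) ((F n).mean_nonneg _))
  · filter_upwards [hq.eventually_one_le_mean ha] with n h2
    have h3 : 0 < ε * (F n).mean (M a n) := mul_pos hε (by linarith)
    have h4 := (F n).chebyshev_upper (fin_le (M a n)) h3.le
    rw [← le_div_iff₀' (by positivity)] at h4
    rwa [add_mul, one_mul]

theorem tendsto_surv_one {a : ℝ} (ha : a ∈ Set.Ioo (0 : ℝ) 1)
    (h : Tendsto (fun n => (F n).mean (M a n) / √((F n).var (M a n))) atTop atTop)
    {t : ℕ → ℝ} (ht : ∀ᶠ n in atTop, 0 < t n)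
    (h' : Tendsto (fun n => t n / (F n).mean (M a n)) atTop (nhds 1))
    {ε : ℝ} (hε : ε ∈ Set.Ioo (0 : ℝ) 1) :
    Tendsto (fun n => (F n).surv (M a n) ((1 - ε) * t n)) atTop (nhds 1) := by
  refine tendsto_of_tendsto_of_tendsto_of_le_of_le' (tendsto_surv_one_of_mean hq ha h
    (ε := ε / 2) ⟨by linarith [hε.1], by linarith [hε.2]⟩) tendsto_const_nhds ?_ ?_
  · have hpos := hq.eventually_one_le_mean ha
    filter_upwards [ht, hpos, eventually_of_tendsto_div_one (hpos.mono fun n => one_pos.trans_le) h'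
      (δ := ε / 2) (by linarith [hε.1])] with n h0 h1 h2
    refine (F n).surv_antitone _ (mul_nonneg (by linarith [hε.2]) h0.le) ?_
    have h3 := mul_le_mul_of_nonneg_left h2.2.le (show 0 ≤ 1 - ε by linarith [hε.2])
    nlinarith [hε.1]
  · exact ht.mono fun n h0 => (F n).surv_le_one _ (mul_nonneg (by linarith [hε.2]) h0.le)

theorem tendsto_surv_zero {a : ℝ} (ha : a ∈ Set.Ioo (0 : ℝ) 1)
    (h : Tendsto (fun n => (F n).mean (M a n) / √((F n).var (M a n))) atTop atTop)
    {t : ℕ → ℝ} (ht : ∀ᶠ n in atTop, 0 < t n)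
    (h' : Tendsto (fun n => t n / (F n).mean (M a n)) atTop (nhds 1))
    {ε : ℝ} (hε : 0 < ε) :
    Tendsto (fun n => (F n).surv (M a n) ((1 + ε) * t n)) atTop (nhds 0) := by
  have hδ : 0 < ε / (2 * (1 + ε)) := by positivity
  refine tendsto_of_tendsto_of_tendsto_of_le_of_le' tendsto_const_nhds
    (tendsto_surv_zero_of_mean hq ha h (ε := ε / 2) (by linarith)) ?_ ?_
  · exact ht.mono fun n h0 => (F n).surv_nonneg _ (mul_nonneg (by linarith) h0.le)
  · have hpos := hq.eventually_one_le_mean ha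
    filter_upwards [ht, hpos, eventually_of_tendsto_div_one (hpos.mono fun n => one_pos.trans_le) h'
      hδ] with n h0 h1 h2
    refine (F n).surv_antitone _ (mul_nonneg (by linarith) (by linarith)) ?_
    have h3 := mul_le_mul_of_nonneg_left h2.1.le (show 0 ≤ 1 + ε by linarith)
    rwa [← mul_assoc, show (1 + ε) * (1 - ε / (2 * (1 + ε))) = 1 + ε / 2 by field_simp; ring] at h3

theorem tendsto_mean_div_mean_of_lt {a b : ℝ} (ha : a ∈ Set.Ioo (0 : ℝ) 1)
    (hb : b ∈ Set.Ioo (0 : ℝ) 1) (hab : a < b)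
    (h : Tendsto (fun n => (F n).mean (M b n) / √((F n).var (M b n))) atTop atTop) :
    Tendsto (fun n => (F n).mean (M a n) / (F n).mean (M b n)) atTop (nhds 1) := by
  have h1 := ((h.inv_tendsto_atTop).div_const a).const_sub 1
  rw [zero_div, sub_zero] at h1
  have hpos := hq.eventually_one_le_mean hb
  refine tendsto_of_tendsto_of_tendsto_of_le_of_le' h1 tendsto_const_nhds ?_ ?_
  · filter_upwards [hpos] with n h2
    have h0 : 0 < (F n).mean (M b n) := one_pos.trans_le h2
    have h3 := (F n).low_mul_mean_sub_le (hq.mono ha hb hab n)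
    have h4 := (F n).mean_mono (hq.mono ha hb hab n)
    have h5 := (mul_le_mul_of_nonneg_right (hq.le_low_succ a ha n) (sub_nonneg.2 h4)).trans h3
    rw [Pi.inv_apply, inv_div, le_div_iff₀ h0, sub_mul, one_mul, div_right_comm,
      div_mul_cancel₀ _ h0.ne', sub_le_comm, le_div_iff₀' ha.1]
    exact h5
  · filter_upwards [hpos] with n h2
    exact div_le_one_of_le₀ ((F n).mean_mono (hq.mono ha hb hab n)) ((F n).mean_nonneg _)

theorem tendsto_mean_div_mean
    (h : ∀ a ∈ Set.Ioo (0 : ℝ) 1,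
      Tendsto (fun n => (F n).mean (M a n) / √((F n).var (M a n))) atTop atTop)
    {a b : ℝ} (ha : a ∈ Set.Ioo (0 : ℝ) 1) (hb : b ∈ Set.Ioo (0 : ℝ) 1) :
    Tendsto (fun n => (F n).mean (M a n) / (F n).mean (M b n)) atTop (nhds 1) := by
  rcases lt_trichotomy a b with hab | rfl | hab
  · exact tendsto_mean_div_mean_of_lt hq ha hb hab (h b hb)
  · refine tendsto_const_nhds.congr' ?_
    filter_upwards [hq.eventually_one_le_mean ha] with n h1
    exact (div_self (by linarith)).symm
  · have := (tendsto_mean_div_mean_of_lt hq hb ha hab (h a ha)).inv₀ one_ne_zero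
    rw [inv_one] at this
    exact this.congr fun n => inv_div _ _

theorem cutoffWith_mean
    (h : ∀ a ∈ Set.Ioo (0 : ℝ) 1,
      Tendsto (fun n => (F n).mean (M a n) / √((F n).var (M a n))) atTop atTop)
    {a : ℝ} (ha : a ∈ Set.Ioo (0 : ℝ) 1) :
    cutoffWith (fun ε n => mixC ((F n).dTVC 0) ε) fun n => (F n).mean (M a n) := by
  have hpos : ∀ᶠ n in atTop, 0 < (F n).mean (M a n) :=
    (hq.eventually_one_le_mean ha).mono fun n => one_pos.trans_le
  exact cutoffWith_of_surv hq hpos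
    (fun b hb ε hε => tendsto_surv_one hq hb (h b hb) hpos (tendsto_mean_div_mean hq h ha hb) hε)
    fun b hb ε hε => tendsto_surv_zero hq hb (h b hb) hpos (tendsto_mean_div_mean hq h ha hb) hε

section

variable {a : ℝ} (ha : a ∈ Set.Ioo (0 : ℝ) 1) {l : ℕ → ℝ}
  (hl : ∀ n, 0 < (M a n : ℕ) → IsSmallestEig ((F n).subIK (M a n)) (l n))
include ha hl

theorem tendsto_mean_mul_eig_iff :
    Tendsto (fun n => (F n).mean (M a n) / √((F n).var (M a n))) atTop atTop ↔
      Tendsto (fun n => (F n).mean (M a n) * l n) atTop atTop := by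
  constructor <;> intro h
  · refine tendsto_atTop_mono' _ ?_ h
    filter_upwards [hq.eventually_pos a ha, hq.eventually_var_pos ha] with n h0 hv
    obtain ⟨h1, h2, -⟩ := (F n).smallestEig_spec h0 (hl n h0)
    have h3 : 1 ≤ l n * √((F n).var (M a n)) := by
      rw [← Real.sqrt_sq h1.le, ← Real.sqrt_mul (sq_nonneg _)]
      exact Real.one_le_sqrt.2 h2
    rw [div_le_iff₀ (Real.sqrt_pos.2 hv), mul_assoc]
    exact le_mul_of_one_le_right ((F n).mean_nonneg _) h3
  · refine tendsto_atTop_mono' _ ?_ (Real.tendsto_sqrt_atTop.comp h)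
    filter_upwards [hq.eventually_pos a ha, hq.eventually_var_pos ha] with n h0 hv
    obtain ⟨h1, -, h2⟩ := (F n).smallestEig_spec h0 (hl n h0)
    rw [Function.comp_apply, le_div_iff₀ (Real.sqrt_pos.2 hv), ← Real.sqrt_mul' _ hv.le]
    refine Real.sqrt_le_iff.2 ⟨(F n).mean_nonneg _, ?_⟩
    rw [mul_assoc, sq]
    exact mul_le_mul_of_nonneg_left h2 ((F n).mean_nonneg _)

/-- If the hitting time does not fall short of `t` but has a chance to be at most `(1 + ε) t`, then
its hazard rate is large compared to `1 / t`. -/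
theorem tendsto_eig_mul {t : ℕ → ℝ} (ht : ∀ n, 0 < t n)
    (h1 : ∀ ε ∈ Set.Ioo (0 : ℝ) 1,
      Tendsto (fun n => (F n).surv (M a n) ((1 - ε) * t n)) atTop (nhds 1))
    {α : ℝ} (hα : α < 1)
    (h2 : ∀ ε > (0 : ℝ), ∀ᶠ n in atTop, (F n).surv (M a n) ((1 + ε) * t n) ≤ α) :
    Tendsto (fun n => l n * t n) atTop atTop := by
  refine tendsto_atTop.2 fun C => ?_
  obtain ⟨ε, hε, hε1, hε2⟩ : ∃ ε > 0, ε < 1 ∧ α < (1 - ε) * Real.exp (-(2 * ε * C)) := by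
    have hlim : Tendsto (fun ε : ℝ => (1 - ε) * Real.exp (-(2 * ε * C)))
        (nhdsWithin 0 (Set.Ioi 0)) (nhds 1) := by
      have : Continuous fun ε : ℝ => (1 - ε) * Real.exp (-(2 * ε * C)) := by fun_prop
      simpa using (this.tendsto 0).mono_left nhdsWithin_le_nhds
    have h1 : ∀ᶠ η : ℝ in nhdsWithin 0 (Set.Ioi 0), η < 1 :=
      (eventually_lt_nhds one_pos).filter_mono nhdsWithin_le_nhds
    obtain ⟨η, h1, h2, h3⟩ := (h1.and ((hlim.eventually_const_lt hα).and
      self_mem_nhdsWithin)).exists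
    exact ⟨η, h3, h1, h2⟩
  filter_upwards [hq.eventually_pos a ha, h2 ε hε,
    (h1 ε ⟨hε, hε1⟩).eventually_const_lt (u := 1 - ε) (by linarith)] with n h0 h3 h4
  by_contra! hlt
  have h5 := (F n).exp_mul_surv_le h0 (hl n h0) (s := (1 - ε) * t n) (r := 2 * ε * t n)
    (mul_nonneg (by linarith) (ht n).le) (mul_nonneg (by linarith) (ht n).le)
  rw [show (1 - ε) * t n + 2 * ε * t n = (1 + ε) * t n by ring] at h5
  have h6 : Real.exp (-(2 * ε * C)) ≤ Real.exp (-(l n * (2 * ε * t n))) :=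
    Real.exp_le_exp.2 (by nlinarith)
  have h7 := mul_le_mul h6 h4.le (by linarith) (Real.exp_pos _).le
  linarith

theorem tendsto_mean_div_sqrt_var {t : ℕ → ℝ} (ht : ∀ n, 0 < t n)
    (h1 : ∀ ε ∈ Set.Ioo (0 : ℝ) 1,
      Tendsto (fun n => (F n).surv (M a n) ((1 - ε) * t n)) atTop (nhds 1))
    {α : ℝ} (hα : α < 1)
    (h2 : ∀ ε > (0 : ℝ), ∀ᶠ n in atTop, (F n).surv (M a n) ((1 + ε) * t n) ≤ α) :
    Tendsto (fun n => (F n).mean (M a n) / √((F n).var (M a n))) atTop atTop := by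
  refine (tendsto_mean_mul_eig_iff hq ha hl).2 (tendsto_atTop_mono' _ ?_
    ((tendsto_eig_mul hq ha hl ht h1 hα h2).const_mul_atTop (show (0 : ℝ) < 1 / 4 by norm_num)))
  filter_upwards [hq.eventually_pos a ha,
    (h1 (1 / 2) ⟨by norm_num, by norm_num⟩).eventually_const_lt (u := 1 / 2) (by norm_num)] with n h0 h3
  have h4 := (F n).mul_surv_le_mean (fin_le (M a n)) (s := (1 - 1 / 2) * t n)
    (mul_nonneg (by norm_num) (ht n).le)
  have h5 := ((F n).smallestEig_spec h0 (hl n h0)).1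
  nlinarith [mul_le_mul_of_nonneg_left h3.le (ht n).le]

end

theorem tendsto_div_mean {a : ℝ} (ha : a ∈ Set.Ioo (0 : ℝ) 1) {t : ℕ → ℝ} (ht : ∀ n, 0 < t n)
    (h : Tendsto (fun n => (F n).mean (M a n) / √((F n).var (M a n))) atTop atTop)
    (h1 : ∀ ε ∈ Set.Ioo (0 : ℝ) 1,
      Tendsto (fun n => (F n).surv (M a n) ((1 - ε) * t n)) atTop (nhds 1))
    {α : ℝ} (hα : α < 1)
    (h2 : ∀ ε > (0 : ℝ), ∀ᶠ n in atTop, (F n).surv (M a n) ((1 + ε) * t n) ≤ α) :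
    Tendsto (fun n => t n / (F n).mean (M a n)) atTop (nhds 1) := by
  have hlim : Tendsto (fun n => (F n).mean (M a n) / t n) atTop (nhds 1) := by
    refine tendsto_div_one_of_eventually (Eventually.of_forall ht) fun δ hδ => ?_
    have hε : δ / 4 ∈ Set.Ioo (0 : ℝ) 1 := ⟨by linarith [hδ.1], by linarith [hδ.2]⟩
    filter_upwards [h2 _ hε.1,
      (tendsto_surv_one_of_mean hq ha h hε).eventually_const_lt hα,
      (tendsto_surv_zero_of_mean hq ha h hε.1).eventually_lt_const (u := 1 / 2) (by norm_num),
      (h1 _ hε).eventually_const_lt (u := 1 / 2) (by norm_num)] with n h3 h4 h5 h6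
    have hm := (F n).mean_nonneg (M a n)
    have h7 : (1 - δ / 4) * (F n).mean (M a n) ≤ (1 + δ / 4) * t n := by
      by_contra! hlt
      have := (F n).surv_antitone (M a n) (mul_nonneg (by linarith [hδ.1]) (ht n).le) hlt.le
      linarith
    have h8 : (1 - δ / 4) * t n ≤ (1 + δ / 4) * (F n).mean (M a n) := by
      by_contra! hlt
      have := (F n).surv_antitone (M a n) (mul_nonneg (by linarith [hδ.1]) hm) hlt.le
      linarith
    have h9 := ht n
    obtain ⟨h10, h11⟩ := hδ
    constructor
    · refine le_of_mul_le_mul_left (le_trans ?_ h8) (show 0 < 1 + δ / 4 by linarith)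
      nlinarith [mul_pos h10 h9, mul_pos (mul_pos h10 h10) h9]
    · refine le_of_mul_le_mul_left (h7.trans ?_) (show 0 < 1 - δ / 4 by linarith)
      nlinarith [mul_pos h10 h9, mul_pos (mul_pos h10 (sub_pos.2 h11)) h9]
  have := hlim.inv₀ one_ne_zero
  rw [inv_one] at this
  exact this.congr fun n => inv_div _ _

theorem cutoffWith_of_eventually_surv_le {lam : ℝ → ℕ → ℝ}
    (hl : ∀ a ∈ Set.Ioo (0 : ℝ) 1, ∀ n, 0 < (M a n : ℕ) →
      IsSmallestEig ((F n).subIK (M a n)) (lam a n))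
    {a : ℝ} (ha : a ∈ Set.Ioo (0 : ℝ) 1) {t : ℕ → ℝ} (ht : ∀ n, 0 < t n)
    (h1 : ∀ ε ∈ Set.Ioo (0 : ℝ) 1,
      Tendsto (fun n => (F n).surv (M a n) ((1 - ε) * t n)) atTop (nhds 1))
    (h2 : ∀ b ∈ Set.Ioo a 1, ∃ α < (1 : ℝ), ∀ ε > (0 : ℝ), ∀ᶠ n in atTop,
      (F n).surv (M b n) ((1 + ε) * t n) ≤ α) :
    cutoffWith (fun ε n => mixC ((F n).dTVC 0) ε) t := by
  have hpos : ∀ᶠ n in atTop, 0 < t n := Eventually.of_forall ht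
  have hunit {b : ℝ} (hb : b ∈ Set.Ioo a 1) : b ∈ Set.Ioo (0 : ℝ) 1 := ⟨ha.1.trans hb.1, hb.2⟩
  have hone {ε : ℝ} (hε : ε ∈ Set.Ioo (0 : ℝ) 1) (c : ℝ) (n : ℕ) :
      (F n).surv (M c n) ((1 - ε) * t n) ≤ 1 :=
    (F n).surv_le_one _ (mul_nonneg (by linarith [hε.2]) (ht n).le)
  have hb1 (b : ℝ) (hb : b ∈ Set.Ioo a 1) (ε : ℝ) (hε : ε ∈ Set.Ioo (0 : ℝ) 1) :
      Tendsto (fun n => (F n).surv (M b n) ((1 - ε) * t n)) atTop (nhds 1) :=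
    tendsto_of_tendsto_of_tendsto_of_le_of_le (h1 ε hε) tendsto_const_nhds
      (fun n => (F n).surv_mono (hq.mono ha (hunit hb) hb.1 n)
        (mul_nonneg (by linarith [hε.2]) (ht n).le)) (hone hε b)
  have hb2 (b : ℝ) (hb : b ∈ Set.Ioo a 1) :
      Tendsto (fun n => (F n).mean (M b n) / √((F n).var (M b n))) atTop atTop := by
    obtain ⟨α, hα, h3⟩ := h2 b hb
    exact tendsto_mean_div_sqrt_var hq (hunit hb) (hl b (hunit hb)) ht (hb1 b hb) hα h3
  have hb3 (b : ℝ) (hb : b ∈ Set.Ioo a 1) :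
      Tendsto (fun n => t n / (F n).mean (M b n)) atTop (nhds 1) := by
    obtain ⟨α, hα, h3⟩ := h2 b hb
    exact tendsto_div_mean hq (hunit hb) ht (hb2 b hb) (hb1 b hb) hα h3
  have hb4 (b : ℝ) (hb : b ∈ Set.Ioo a 1) (ε : ℝ) (hε : 0 < ε) :
      Tendsto (fun n => (F n).surv (M b n) ((1 + ε) * t n)) atTop (nhds 0) :=
    tendsto_surv_zero hq (hunit hb) (hb2 b hb) hpos (hb3 b hb) hε
  have hb : (a + 1) / 2 ∈ Set.Ioo a 1 := ⟨by linarith [ha.2], by linarith [ha.2]⟩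
  set b := (a + 1) / 2
  refine cutoffWith_of_surv hq hpos (fun c hc ε hε => ?_) fun c hc ε hε => ?_
  · rcases lt_or_ge a c with hac | hac
    · exact hb1 c ⟨hac, hc.2⟩ ε hε
    have hcb : c < b := hac.trans_lt hb.1
    have hratio := tendsto_mean_div_mean_of_lt hq hc (hunit hb) hcb (hb2 b hb)
    have hlim := (hb1 b hb (ε / 2) ⟨by linarith [hε.1], by linarith [hε.2]⟩).sub
      (((hratio.const_sub 1).div (hb3 b hb) one_ne_zero).div_const (ε / 2))
    rw [sub_self, zero_div, zero_div, sub_zero] at hlim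
    refine tendsto_of_tendsto_of_tendsto_of_le_of_le' hlim tendsto_const_nhds ?_
      (Eventually.of_forall (hone hε c))
    filter_upwards [hq.eventually_one_le_mean (hunit hb)] with n hm
    have hr : 0 < ε / 2 * t n := mul_pos (by linarith [hε.1]) (ht n)
    have h3 := (F n).surv_sub_le (hq.mono hc (hunit hb) hcb n) (fin_le _)
      (s := (1 - ε) * t n) (mul_nonneg (by linarith [hε.2]) (ht n).le) hr.le
    rw [show (1 - ε) * t n + ε / 2 * t n = (1 - ε / 2) * t n by ring, ← le_div_iff₀' hr] at h3
    have h4 : (1 - (F n).mean (M c n) / (F n).mean (M b n)) / (t n / (F n).mean (M b n)) / (ε / 2)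
        = ((F n).mean (M b n) - (F n).mean (M c n)) / (ε / 2 * t n) := by
      have h5 : (F n).mean (M b n) ≠ 0 := by linarith
      have h6 := (ht n).ne'
      have h7 := hε.1.ne'
      field_simp
    simp only [Pi.div_apply, h4]
    linarith
  · rcases lt_or_ge a c with hac | hac
    · exact hb4 c ⟨hac, hc.2⟩ ε hε
    have hcb : c < b := hac.trans_lt hb.1
    have hnn (n : ℕ) : 0 ≤ (1 + ε) * t n := mul_nonneg (by linarith) (ht n).le
    exact tendsto_of_tendsto_of_tendsto_of_le_of_le tendsto_const_nhds (hb4 b hb ε hε)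
      (fun n => (F n).surv_nonneg _ (hnn n))
      fun n => (F n).surv_mono (hq.mono hc (hunit hb) hcb n) (hnn n)

end

end BDChain

/-- Theorem `t-tv3`.  Equivalent conditions for a total variation cutoff
of the continuous-time family started at the left boundary state, assuming `π_n(0) → 0`:
(1) cutoff; (2) `u_n(a)/v_n(a) → ∞` for all `a`; (3) `u_n(a)λ_n(a) → ∞` for all `a`;
(4) existence of `a` and a sequence `t_n = O(u_n(c))` concentrating the hitting time
`τ̃_{M_n(a)}`.  Moreover under (2)/(3) any `u_n(a)` is a cutoff time, and under (4) `t_n` is. -/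
theorem birth_death_left_TV_cutoff_characterization
    (F : (n : ℕ) → BDChain n)
    (M : ℝ → (n : ℕ) → Fin (n + 1))
    (hM : ∀ a ∈ Set.Ioo (0 : ℝ) 1, ∀ n,
      a ≤ (F n).piLow (M a n) ∧ 1 - a ≤ (F n).piHigh (M a n))
    (lam : ℝ → ℕ → ℝ)
    (hlam : ∀ a ∈ Set.Ioo (0 : ℝ) 1, ∀ n, 0 < ((M a n : ℕ)) →
      IsSmallestEig ((F n).subIK (M a n)) (lam a n))
    (u v : ℝ → ℕ → ℝ)
    (hu : ∀ a n, u a n = (F n).hitMeanC (M a n) 0)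
    (hv : ∀ a n, v a n = Real.sqrt ((F n).hitVarC (M a n) 0))
    (hπ0 : Filter.Tendsto (fun n => (F n).pi 0) Filter.atTop (nhds 0)) :
    -- (1) ↔ (2)
    (hasCutoff (fun ε n => mixC ((F n).dTVC 0) ε) ↔
      (∀ a ∈ Set.Ioo (0 : ℝ) 1,
        Filter.Tendsto (fun n => u a n / v a n) Filter.atTop Filter.atTop)) ∧
    -- (2) ↔ (3)
    ((∀ a ∈ Set.Ioo (0 : ℝ) 1,
        Filter.Tendsto (fun n => u a n / v a n) Filter.atTop Filter.atTop) ↔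
      (∀ a ∈ Set.Ioo (0 : ℝ) 1,
        Filter.Tendsto (fun n => u a n * lam a n) Filter.atTop Filter.atTop)) ∧
    -- (1) ↔ (4)
    (hasCutoff (fun ε n => mixC ((F n).dTVC 0) ε) ↔
      (∃ a ∈ Set.Ioo (0 : ℝ) 1, ∃ t : ℕ → ℝ, (∀ n, 0 < t n) ∧
        (∀ c ∈ Set.Ioo (0 : ℝ) 1, ∃ C : ℝ, ∀ᶠ n in Filter.atTop, t n ≤ C * u c n) ∧
        (∀ ε ∈ Set.Ioo (0 : ℝ) 1,
          Filter.Tendsto (fun n => (F n).hitSurvC (M a n) 0 ((1 - ε) * t n))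
            Filter.atTop (nhds 1)) ∧
        (∀ b ∈ Set.Ioo a 1, ∃ αb ∈ Set.Ioo (0 : ℝ) 1, ∀ ε > (0 : ℝ),
          Filter.limsup (fun n => (F n).hitSurvC (M b n) 0 ((1 + ε) * t n))
            Filter.atTop ≤ αb))) ∧
    -- cutoff times under (2)
    ((∀ a ∈ Set.Ioo (0 : ℝ) 1,
        Filter.Tendsto (fun n => u a n / v a n) Filter.atTop Filter.atTop) →
      ∀ a ∈ Set.Ioo (0 : ℝ) 1,
        cutoffWith (fun ε n => mixC ((F n).dTVC 0) ε) (u a)) ∧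
    -- cutoff time under (4)
    (∀ a ∈ Set.Ioo (0 : ℝ) 1, ∀ t : ℕ → ℝ, (∀ n, 0 < t n) →
      (∀ c ∈ Set.Ioo (0 : ℝ) 1, ∃ C : ℝ, ∀ᶠ n in Filter.atTop, t n ≤ C * u c n) →
      (∀ ε ∈ Set.Ioo (0 : ℝ) 1,
        Filter.Tendsto (fun n => (F n).hitSurvC (M a n) 0 ((1 - ε) * t n))
          Filter.atTop (nhds 1)) →
      (∀ b ∈ Set.Ioo a 1, ∃ αb ∈ Set.Ioo (0 : ℝ) 1, ∀ ε > (0 : ℝ),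
        Filter.limsup (fun n => (F n).hitSurvC (M b n) 0 ((1 + ε) * t n))
          Filter.atTop ≤ αb) →
      cutoffWith (fun ε n => mixC ((F n).dTVC 0) ε) t) := by
  have hq : BDChain.IsQuantile F M :=
    { low_le := fun a ha n => by
        have h := (hM a ha n).2
        rw [BDChain.piHigh_eq_low] at h
        linarith
      le_low_succ := fun a ha n => (hM a ha n).1.trans_eq ((F n).piLow_eq_low _)
      eventually_pos := fun a ha => by
        filter_upwards [hπ0.eventually_lt_const ha.1] with n h
        by_contra! h0
        have h1 := (hM a ha n).1
        rw [BDChain.piLow_eq_low, Nat.le_zero.1 h0, BDChain.low, Finset.sum_range_one] at h1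
        exact absurd (h1.trans_eq ((F n).weight_fin 0)) (not_le.2 h) }
  have hu' (a : ℝ) (ha : a ∈ Set.Ioo (0 : ℝ) 1) :
      (fun n => (F n).mean (M a n)) =ᶠ[atTop] u a :=
    (hq.eventually_pos a ha).mono fun n h => by beta_reduce; rw [hu, (F n).hitMeanC_eq _ h]
  have hv' (a : ℝ) (ha : a ∈ Set.Ioo (0 : ℝ) 1) :
      (fun n => √((F n).var (M a n))) =ᶠ[atTop] v a :=
    (hq.eventually_pos a ha).mono fun n h => by beta_reduce; rw [hv, (F n).hitVarC_eq _ h]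
  have huv (a : ℝ) (ha : a ∈ Set.Ioo (0 : ℝ) 1) :
      Tendsto (fun n => (F n).mean (M a n) / √((F n).var (M a n))) atTop atTop ↔
        Tendsto (fun n => u a n / v a n) atTop atTop :=
    tendsto_congr' ((hu' a ha).div (hv' a ha))
  have hul (a : ℝ) (ha : a ∈ Set.Ioo (0 : ℝ) 1) :
      Tendsto (fun n => (F n).mean (M a n) * lam a n) atTop atTop ↔
        Tendsto (fun n => u a n * lam a n) atTop atTop :=
    tendsto_congr' ((hu' a ha).mul EventuallyEq.rfl)
  have hcongr (t t' : ℕ → ℝ) (htt : t =ᶠ[atTop] t')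
      (h : cutoffWith (fun ε n => mixC ((F n).dTVC 0) ε) t) :
      cutoffWith (fun ε n => mixC ((F n).dTVC 0) ε) t' := fun ε hε =>
    (h ε hε).congr' (EventuallyEq.rfl.div htt)
  have h25 (h : ∀ a ∈ Set.Ioo (0 : ℝ) 1, Tendsto (fun n => u a n / v a n) atTop atTop)
      (a : ℝ) (ha : a ∈ Set.Ioo (0 : ℝ) 1) :
      cutoffWith (fun ε n => mixC ((F n).dTVC 0) ε) (u a) :=
    hcongr _ _ (hu' a ha)
      (BDChain.cutoffWith_mean hq (fun b hb => (huv b hb).2 (h b hb)) ha)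
  have h45 (a : ℝ) (ha : a ∈ Set.Ioo (0 : ℝ) 1) (t : ℕ → ℝ) (ht : ∀ n, 0 < t n)
      (h1 : ∀ ε ∈ Set.Ioo (0 : ℝ) 1,
        Tendsto (fun n => (F n).hitSurvC (M a n) 0 ((1 - ε) * t n)) atTop (nhds 1))
      (h2 : ∀ b ∈ Set.Ioo a 1, ∃ αb ∈ Set.Ioo (0 : ℝ) 1, ∀ ε > (0 : ℝ),
        limsup (fun n => (F n).hitSurvC (M b n) 0 ((1 + ε) * t n)) atTop ≤ αb) :
      cutoffWith (fun ε n => mixC ((F n).dTVC 0) ε) t := by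
    simp only [BDChain.hitSurvC_eq] at h1 h2
    refine BDChain.cutoffWith_of_eventually_surv_le hq hlam ha ht h1 fun b hb => ?_
    obtain ⟨α, hα, h⟩ := h2 b hb
    refine ⟨(α + 1) / 2, by linarith [hα.2], fun ε hε => ?_⟩
    refine (eventually_lt_of_limsup_lt ((h ε hε).trans_lt (by linarith [hα.2])) ?_).mono
      fun n => le_of_lt
    exact isBoundedUnder_of ⟨1, fun n => (F n).surv_le_one _
      (mul_nonneg (by linarith) (ht n).le)⟩
  have h1S (t : ℕ → ℝ) (ht : ∀ n, 0 < t n)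
      (h : cutoffWith (fun ε n => mixC ((F n).dTVC 0) ε) t) (a : ℝ)
      (ha : a ∈ Set.Ioo (0 : ℝ) 1) (ε : ℝ) (hε : ε ∈ Set.Ioo (0 : ℝ) 1) :=
    BDChain.tendsto_surv_one_of_cutoffWith hq ht h ha hε
  refine ⟨⟨?_, fun h => ?_⟩, ?_, ⟨?_, ?_⟩, h25, fun a ha t ht _ => h45 a ha t ht⟩
  · rintro ⟨t, ht, h⟩ a ha
    exact (huv a ha).1 (BDChain.tendsto_mean_div_sqrt_var hq ha (hlam a ha) ht (h1S t ht h a ha)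
      (α := (a + 1) / 2) (by linarith [ha.2]) fun ε hε =>
        BDChain.eventually_surv_le_of_cutoffWith hq ht h ha (by linarith [ha.2])
          (by linarith [ha.2]) hε)
  · have ha : (1 / 2 : ℝ) ∈ Set.Ioo (0 : ℝ) 1 := ⟨by norm_num, by norm_num⟩
    refine ⟨fun n => if 0 < u (1 / 2) n then u (1 / 2) n else 1, fun n => ?_,
      hcongr _ _ ?_ (h25 h _ ha)⟩
    · beta_reduce
      split_ifs with h0
      exacts [h0, one_pos]
    · filter_upwards [hu' _ ha, hq.eventually_one_le_mean ha] with n h1 h2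
      rw [if_pos (by linarith)]
  · exact forall₂_congr fun a ha => (huv a ha).symm.trans
      ((BDChain.tendsto_mean_mul_eig_iff hq ha (hlam a ha)).trans (hul a ha))
  · rintro ⟨t, ht, h⟩
    refine ⟨1 / 2, ⟨by norm_num, by norm_num⟩, t, ht, fun c hc => ⟨4, ?_⟩, fun ε hε => ?_,
      fun b hb => ?_⟩
    · filter_upwards [hu' c hc, (h1S t ht h c hc (1 / 2)
        ⟨by norm_num, by norm_num⟩).eventually_const_lt (u := 1 / 2) (by norm_num)] with n h1 h2
      have h3 := (F n).mul_surv_le_mean (BDChain.fin_le (M c n)) (s := (1 - 1 / 2) * t n)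
        (mul_nonneg (by norm_num) (ht n).le)
      nlinarith [mul_le_mul_of_nonneg_left h2.le (ht n).le]
    · simp only [BDChain.hitSurvC_eq]
      exact h1S t ht h _ ⟨by norm_num, by norm_num⟩ ε hε
    · obtain ⟨hb0, hb1⟩ := hb
      refine ⟨(b + 1) / 2, ⟨by linarith, by linarith⟩, fun ε hε => ?_⟩
      simp only [BDChain.hitSurvC_eq]
      refine limsup_le_of_le ?_ (BDChain.eventually_surv_le_of_cutoffWith hq ht h
        ⟨by linarith, hb1⟩ (by linarith) (by linarith) hε)
      exact (isBoundedUnder_of ⟨0, fun n => (F n).surv_nonneg _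
        (mul_nonneg (by linarith) (ht n).le)⟩).isCoboundedUnder_flip
  · rintro ⟨a, ha, t, ht, -, h1, h2⟩
    exact ⟨t, ht, h45 a ha t ht h1 h2⟩

end
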